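/- There exists a constant C > 0, independent of ε and N, such that for every ε ∈ (0,1] and every integer N ≥ 4 divisible by 4 the following holds: if y is the unique solution of the nonlinear discrete scheme on the Shishkin mesh X_0 < … < X_N with γ₀ = min{c₀,1}, and y^I : [0,1] → ℝ is the continuous piecewise linear interpolant with y^I(X_i) = y_i for all i, then max_{x∈[0,1]} |y^I(x) − u(x)| ≤ C N^{−2} (ln N)², where u is the solution of the continuous problem. -/

import Mathlib

open Set Real

noncomputable section

/-- first partial derivative of `f(x,u)` with respect to `u` -/
def pderiv1 (f : ℝ → ℝ → ℝ) (x y : ℝ) : ℝ := deriv (fun z => f x z) y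

/-- second partial derivative of `f(x,u)` with respect to `u` -/
def pderiv2 (f : ℝ → ℝ → ℝ) (x y : ℝ) : ℝ :=
  deriv (fun z => deriv (fun w => f x w) z) y

/-- `f` is four times continuously differentiable on `[0,1] × ℝ`. -/
def SmoothF (f : ℝ → ℝ → ℝ) : Prop :=
  ContDiffOn ℝ 4 (fun p : ℝ × ℝ => f p.1 p.2) ((Icc (0:ℝ) 1) ×ˢ (univ : Set ℝ))

/-- the stability condition `f_u(x,u) ≥ c₀² > 0` on `[0,1] × ℝ` -/
def LowerF (f : ℝ → ℝ → ℝ) (c₀ : ℝ) : Prop :=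
  ∀ x ∈ Icc (0:ℝ) 1, ∀ y : ℝ, c₀ ^ 2 ≤ pderiv1 f x y

/-- `u` is a C⁴-solution of the semilinear BVP `-ε²u'' + f(x,u) = 0`, `u(0)=u(1)=0`. -/
def IsSolution (f : ℝ → ℝ → ℝ) (ε : ℝ) (u : ℝ → ℝ) : Prop :=
  ContDiffOn ℝ 4 u (Icc (0:ℝ) 1) ∧
  (∀ x ∈ Ioo (0:ℝ) 1,
    -ε ^ 2 * iteratedDerivWithin 2 u (Icc (0:ℝ) 1) x + f x (u x) = 0) ∧
  u 0 = 0 ∧ u 1 = 0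

/-- the constant `l = c₀⁻² · max_{[0,1]} |f(x,0)|` -/
def lconst (f : ℝ → ℝ → ℝ) (c₀ : ℝ) : ℝ :=
  c₀ ^ (-2 : ℤ) * sSup ((fun x => |f x 0|) '' Icc (0:ℝ) 1)

/-- the constant `θ = max { |f_uu(x,ξ)| : x ∈ [0,1], |ξ| ≤ l + 2ρ }` -/
def thconst (f : ℝ → ℝ → ℝ) (c₀ ρ : ℝ) : ℝ :=
  sSup ((fun p : ℝ × ℝ => |pderiv2 f p.1 p.2|) ''
    ((Icc (0:ℝ) 1) ×ˢ (Icc (-(lconst f c₀ + 2*ρ)) (lconst f c₀ + 2*ρ))))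

/-- discrete second difference `y_{x̄x̂,i}` on a nonuniform mesh `x` (for `1 ≤ i`),
using `ℏ_i = (h_i + h_{i+1})/2 = (x_{i+1} - x_{i-1})/2`. -/
def ddiff (x y : ℕ → ℝ) (i : ℕ) : ℝ :=
  2 / (x (i+1) - x (i-1)) *
    ((y (i+1) - y i) / (x (i+1) - x i) - (y i - y (i-1)) / (x i - x (i-1)))

/-- Shishkin mesh generating function with transition parameter
`α = min(1/4, 2γ₀⁻¹ ε ln n)`. -/
def shishkinLam (γ₀ ε : ℝ) (n : ℕ) (t : ℝ) : ℝ :=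
  let α := min (1/4) (2 * γ₀⁻¹ * ε * Real.log n)
  if t ≤ 1/4 then 4*α*t
  else if t ≤ 1/2 then α + 2*(1-2*α)*(t-1/4)
  else 1 - (if 1-t ≤ 1/4 then 4*α*(1-t) else α + 2*(1-2*α)*((1-t)-1/4))

/-- Shishkin mesh nodes `x_i = λ(i/n)` -/
def shishkinMesh (γ₀ ε : ℝ) (n i : ℕ) : ℝ := shishkinLam γ₀ ε n ((i:ℝ)/(n:ℝ))

def bakhPhi (a ε q t : ℝ) : ℝ := a*ε*Real.log (q/(q-t))

/-- derivative of `bakhPhi` -/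
def bakhPhi' (a ε q t : ℝ) : ℝ := a*ε/(q-t)

/-- `α ∈ (0,q)` is the abscissa of the contact point of the tangent line from
`(1/2,1/2)` to `φ`, i.e. `φ(α) + φ'(α)(1/2 - α) = 1/2`. -/
def IsBakhAlpha (a ε q α : ℝ) : Prop :=
  α ∈ Ioo 0 q ∧ bakhPhi a ε q α + bakhPhi' a ε q α * (1/2 - α) = 1/2

/-- Bakhvalov mesh generating function -/
def bakhLam (a ε q α t : ℝ) : ℝ :=
  if t ≤ α then bakhPhi a ε q t
  else if t ≤ 1/2 then bakhPhi a ε q α + bakhPhi' a ε q α * (t-α)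
  else 1 - (if 1-t ≤ α then bakhPhi a ε q (1-t)
            else bakhPhi a ε q α + bakhPhi' a ε q α * ((1-t)-α))

/-- Bakhvalov mesh nodes `x_i = λ(i/n)` -/
def bakhMesh (a ε q α : ℝ) (n i : ℕ) : ℝ := bakhLam a ε q α ((i:ℝ)/(n:ℝ))

def vulAlpha (a ε q : ℝ) : ℝ :=
  (q - Real.sqrt (ε*a*q*(1-2*q+2*ε*a)))/(1+2*ε*a)

def vulMu (a ε q t : ℝ) : ℝ := a*ε*t/(q-t)

/-- derivative of `vulMu` -/
def vulMu' (a ε q t : ℝ) : ℝ := a*ε*q/(q-t)^2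

/-- Vulanović mesh generating function -/
def vulLam (a ε q t : ℝ) : ℝ :=
  let α := vulAlpha a ε q
  if t ≤ α then vulMu a ε q t
  else if t ≤ 1/2 then vulMu a ε q α + vulMu' a ε q α * (t-α)
  else 1 - (if 1-t ≤ α then vulMu a ε q (1-t)
            else vulMu a ε q α + vulMu' a ε q α * ((1-t)-α))

/-- Vulanović mesh nodes `x_i = λ(i/n)` -/
def vulMesh (a ε q : ℝ) (n i : ℕ) : ℝ := vulLam a ε q ((i:ℝ)/(n:ℝ))

/-- the three-point discrete scheme for the linear problem
`-ε² y_{x̄x̂,i} + b(x_i) y_i = g(x_i)`, `y_0 = y_n = 0` -/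
def LinScheme (bc gc : ℝ → ℝ) (ε : ℝ) (x : ℕ → ℝ) (n : ℕ) (y : ℕ → ℝ) : Prop :=
  (∀ i : ℕ, 1 ≤ i → i < n →
    -ε ^ 2 * ddiff x y i + bc (x i) * y i = gc (x i)) ∧
  y 0 = 0 ∧ y n = 0

/-- the nonlinear discrete scheme `-ε² y_{x̄x̂,i} + f(x_i, y_i) = 0`, `y_0 = y_n = 0` -/
def NonlinScheme (f : ℝ → ℝ → ℝ) (ε : ℝ) (x : ℕ → ℝ) (n : ℕ) (y : ℕ → ℝ) : Prop :=
  (∀ i : ℕ, 1 ≤ i → i < n → -ε ^ 2 * ddiff x y i + f (x i) (y i) = 0) ∧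
  y 0 = 0 ∧ y n = 0

/-- `u` is a C²-solution of the continuous linear problem
`-ε²u'' + b(x)u = g(x)`, `u(0)=u(1)=0`. -/
def IsLinSolution (bc gc : ℝ → ℝ) (ε : ℝ) (u : ℝ → ℝ) : Prop :=
  ContDiffOn ℝ 2 u (Icc (0:ℝ) 1) ∧
  (∀ x ∈ Ioo (0:ℝ) 1,
    -ε ^ 2 * iteratedDerivWithin 2 u (Icc (0:ℝ) 1) x + bc x * u x = gc x) ∧
  u 0 = 0 ∧ u 1 = 0

/-- `b(x,ε)` is three times continuously differentiable in `x` on `[0,1]`,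
with these derivatives bounded uniformly in `ε ∈ [0,1]`. -/
def UnifC3 (b : ℝ → ℝ → ℝ) : Prop :=
  ∃ M : ℝ, ∀ ε ∈ Icc (0:ℝ) 1,
    ContDiffOn ℝ 3 (fun x => b x ε) (Icc (0:ℝ) 1) ∧
    ∀ j : ℕ, j ≤ 3 → ∀ x ∈ Icc (0:ℝ) 1,
      |iteratedDerivWithin j (fun x => b x ε) (Icc (0:ℝ) 1) x| ≤ M

/-- `w` is the continuous piecewise-linear interpolant of mesh data `y`
on the mesh `x_0 < … < x_n`. -/
def IsLinInterp (x : ℕ → ℝ) (n : ℕ) (y : ℕ → ℝ) (w : ℝ → ℝ) : Prop :=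
  (∀ i ≤ n, w (x i) = y i) ∧
  ∀ i < n, ∀ t ∈ Icc (x i) (x (i+1)),
    w t = y i + (y (i+1) - y i) * (t - x i) / (x (i+1) - x i)

/-- properties of the initial guess `u⁰`: of class C³, within `ρ` of the
solution `u`, and satisfying ε-uniform bounds of layer type for `j = 0, 1`. -/
def InitGuess (c₀ ε C₀ ρ : ℝ) (u u0 : ℝ → ℝ) : Prop :=
  ContDiffOn ℝ 3 u0 (Icc (0:ℝ) 1) ∧
  (∀ x ∈ Icc (0:ℝ) 1, |u0 x - u x| ≤ ρ) ∧
  (∀ x ∈ Icc (0:ℝ) 1, |u0 x| ≤ C₀) ∧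
  (∀ x ∈ Icc (0:ℝ) 1, |derivWithin u0 (Icc (0:ℝ) 1) x| ≤
    C₀ * (1 + ε⁻¹ * (Real.exp (-c₀*x/ε) + Real.exp (-c₀*(1-x)/ε))))

/-- the discrete Newton (quasilinearization) iterates on the mesh `x`:
`y⁰_i = u⁰(x_i)` and `y^{m+1}` solves the quasilinearized discrete problem. -/
def NewtonIter (f : ℝ → ℝ → ℝ) (ε : ℝ) (x : ℕ → ℝ) (n : ℕ) (u0 : ℝ → ℝ)
    (Y : ℕ → ℕ → ℝ) : Prop :=
  (∀ i ≤ n, Y 0 i = u0 (x i)) ∧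
  ∀ m : ℕ,
    (∀ i : ℕ, 1 ≤ i → i < n →
      -ε ^ 2 * ddiff x (Y (m+1)) i + pderiv1 f (x i) (Y m i) * Y (m+1) i
        = -f (x i) (Y m i) + pderiv1 f (x i) (Y m i) * Y m i) ∧
    Y (m+1) 0 = 0 ∧ Y (m+1) n = 0

open Set Real

/-- continuous on `[a,b]`, with first and second derivatives on `(a,b)` -/
structure C2On (a b : ℝ) (g g1 g2 : ℝ → ℝ) : Prop where
  cont : ContinuousOn g (Icc a b)
  d1 : ∀ x ∈ Ioo a b, HasDerivAt g (g1 x) x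
  d2 : ∀ x ∈ Ioo a b, HasDerivAt g1 (g2 x) x

lemma C2On.mono {a b a' b' : ℝ} {g g1 g2 : ℝ → ℝ} (h : C2On a b g g1 g2) (ha : a ≤ a')
    (hb : b' ≤ b) : C2On a' b' g g1 g2 :=
  ⟨h.cont.mono (Icc_subset_Icc ha hb), fun x hx => h.d1 x (Ioo_subset_Ioo ha hb hx),
    fun x hx => h.d2 x (Ioo_subset_Ioo ha hb hx)⟩

lemma C2On.add {a b : ℝ} {g g1 g2 k k1 k2 : ℝ → ℝ} (h : C2On a b g g1 g2)
    (h' : C2On a b k k1 k2) :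
    C2On a b (fun x => g x + k x) (fun x => g1 x + k1 x) (fun x => g2 x + k2 x) :=
  ⟨h.cont.add h'.cont, fun x hx => (h.d1 x hx).add (h'.d1 x hx),
    fun x hx => (h.d2 x hx).add (h'.d2 x hx)⟩

lemma C2On.sub {a b : ℝ} {g g1 g2 k k1 k2 : ℝ → ℝ} (h : C2On a b g g1 g2)
    (h' : C2On a b k k1 k2) :
    C2On a b (fun x => g x - k x) (fun x => g1 x - k1 x) (fun x => g2 x - k2 x) :=
  ⟨h.cont.sub h'.cont, fun x hx => (h.d1 x hx).sub (h'.d1 x hx),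
    fun x hx => (h.d2 x hx).sub (h'.d2 x hx)⟩

lemma C2On.cmul {a b : ℝ} {g g1 g2 : ℝ → ℝ} (c : ℝ) (h : C2On a b g g1 g2) :
    C2On a b (fun x => c * g x) (fun x => c * g1 x) (fun x => c * g2 x) :=
  ⟨h.cont.const_mul c, fun x hx => (h.d1 x hx).const_mul c,
    fun x hx => (h.d2 x hx).const_mul c⟩

lemma C2On.const {a b : ℝ} (c : ℝ) : C2On a b (fun _ => c) (fun _ => 0) (fun _ => 0) :=
  ⟨continuousOn_const, fun x _ => hasDerivAt_const x c, fun x _ => hasDerivAt_const x 0⟩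

lemma C2On.sq {a b : ℝ} : C2On a b (fun x => x ^ 2 / 2) (fun x => x) (fun _ => 1) := by
  refine ⟨by fun_prop, fun x _ => ?_, fun x _ => hasDerivAt_id x⟩
  have := ((hasDerivAt_id x).pow 2).div_const 2
  simpa using this

lemma C2On.convex {a b : ℝ} {g g1 g2 : ℝ → ℝ} (h : C2On a b g g1 g2)
    (h0 : ∀ x ∈ Ioo a b, 0 ≤ g2 x) : ConvexOn ℝ (Icc a b) g := by
  apply convexOn_of_hasDerivWithinAt2_nonneg (convex_Icc a b) h.cont (f' := g1) (f'' := g2)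
  all_goals rw [interior_Icc]
  · exact fun x hx => (h.d1 x hx).hasDerivWithinAt
  · exact fun x hx => (h.d2 x hx).hasDerivWithinAt
  · exact h0

lemma convex_mid {a b x s : ℝ} {g : ℝ → ℝ} (h : ConvexOn ℝ (Icc a b) g) (hs : 0 ≤ s)
    (ha : a ≤ x - s) (hb : x + s ≤ b) : 2 * g x ≤ g (x + s) + g (x - s) := by
  have m1 : x + s ∈ Icc a b := ⟨by linarith, hb⟩
  have m2 : x - s ∈ Icc a b := ⟨ha, by linarith⟩
  have := h.2 m1 m2 (show (0:ℝ) ≤ 1/2 by norm_num) (show (0:ℝ) ≤ 1/2 by norm_num) (by norm_num)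
  simp only [smul_eq_mul] at this
  rw [show 1/2 * (x+s) + 1/2 * (x - s) = x by ring] at this
  linarith

lemma second_diff_bound {a b x s : ℝ} {p p1 p2 Q Q1 Q2 : ℝ → ℝ} (hp : C2On a b p p1 p2)
    (hQ : C2On a b Q Q1 Q2) (h : ∀ t ∈ Ioo a b, |p2 t| ≤ Q2 t) (hs : 0 ≤ s)
    (ha : a ≤ x - s) (hb : x + s ≤ b) :
    |p (x + s) + p (x - s) - 2 * p x| ≤ Q (x + s) + Q (x - s) - 2 * Q x := by
  have h1 := convex_mid ((hQ.add hp).convex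
    (fun t ht => by have := (abs_le.1 (h t ht)).1; linarith)) hs ha hb
  have h2 := convex_mid ((hQ.sub hp).convex
    (fun t ht => by have := (abs_le.1 (h t ht)).2; linarith)) hs ha hb
  rw [abs_le]; constructor <;> linarith

lemma convex_chord {a b t : ℝ} {g : ℝ → ℝ} (h : ConvexOn ℝ (Icc a b) g) (hab : a < b)
    (ht : t ∈ Icc a b) : g t ≤ g a + (g b - g a) * (t - a) / (b - a) := by
  have hb : 0 < b - a := by linarith
  have m1 : 0 ≤ (b - t) / (b - a) := div_nonneg (by linarith [ht.2]) hb.le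
  have m2 : 0 ≤ (t - a) / (b - a) := div_nonneg (by linarith [ht.1]) hb.le
  have := h.2 (left_mem_Icc.2 hab.le) (right_mem_Icc.2 hab.le) m1 m2 (by field_simp; ring)
  simp only [smul_eq_mul] at this
  rw [show (b - t) / (b - a) * a + (t - a) / (b - a) * b = t by field_simp; ring] at this
  refine this.trans (le_of_eq ?_)
  field_simp; ring

lemma interp_bound {a b t : ℝ} {p p1 p2 Q Q1 Q2 : ℝ → ℝ} (hp : C2On a b p p1 p2)
    (hQ : C2On a b Q Q1 Q2) (h : ∀ t ∈ Ioo a b, |p2 t| ≤ Q2 t) (hab : a < b)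
    (ht : t ∈ Icc a b) :
    |p a + (p b - p a) * (t - a) / (b - a) - p t|
      ≤ Q a + (Q b - Q a) * (t - a) / (b - a) - Q t := by
  have h1 := convex_chord ((hQ.add hp).convex
    (fun t ht => by have := (abs_le.1 (h t ht)).1; linarith)) hab ht
  have h2 := convex_chord ((hQ.sub hp).convex
    (fun t ht => by have := (abs_le.1 (h t ht)).2; linarith)) hab ht
  have e1 : (Q b + p b - (Q a + p a)) * (t - a) / (b - a)
    = (Q b - Q a) * (t - a) / (b - a) + (p b - p a) * (t - a) / (b - a) := by ring
  have e2 : (Q b - p b - (Q a - p a)) * (t - a) / (b - a)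
    = (Q b - Q a) * (t - a) / (b - a) - (p b - p a) * (t - a) / (b - a) := by ring
  rw [e1] at h1
  rw [e2] at h2
  rw [abs_le]; constructor <;> linarith

lemma ddiff_lower {a b c m : ℝ} {U U1 U2 : ℝ → ℝ} (hU : C2On a c U U1 U2) (hab : a < b)
    (hbc : b < c) (h : ∀ t ∈ Ioo a c, m ≤ U2 t) :
    m ≤ 2 / (c - a) * ((U c - U b) / (c - b) - (U b - U a) / (b - a)) := by
  have h1 := ((hU.sub (C2On.sq.cmul m)).convex
    (fun t ht => by have := h t ht; linarith)).slope_mono_adjacent (x := a) (y := b) (z := c)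
    ⟨le_rfl, by linarith⟩ ⟨by linarith, le_rfl⟩ hab hbc
  have hb : 0 < b - a := by linarith
  have hc : 0 < c - b := by linarith
  have hca : 0 < c - a := by linarith
  have e1 : (U b - m * (b ^ 2 / 2) - (U a - m * (a ^ 2 / 2))) / (b - a)
    = (U b - U a) / (b - a) - m * (b + a) / 2 := by field_simp; ring
  have e2 : (U c - m * (c ^ 2 / 2) - (U b - m * (b ^ 2 / 2))) / (c - b)
    = (U c - U b) / (c - b) - m * (c + b) / 2 := by field_simp; ring
  rw [e1, e2] at h1
  rw [div_mul_eq_mul_div, le_div_iff₀ hca]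
  linarith

lemma ddiff_bound {a b c m D : ℝ} {U U1 U2 : ℝ → ℝ} (hU : C2On a c U U1 U2) (hab : a < b)
    (hbc : b < c) (h : ∀ t ∈ Ioo a c, |U2 t - m| ≤ D) :
    |2 / (c - a) * ((U c - U b) / (c - b) - (U b - U a) / (b - a)) - m| ≤ D := by
  have h1 := ddiff_lower (m := m - D) hU hab hbc
    (fun t ht => by have := (abs_le.1 (h t ht)).1; linarith)
  have h2 := ddiff_lower (m := -(m + D)) (hU.cmul (-1)) hab hbc
    (fun t ht => by have := (abs_le.1 (h t ht)).2; linarith)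
  have e : 2 / (c - a) * ((-1 * U c - -1 * U b) / (c - b) - (-1 * U b - -1 * U a) / (b - a))
    = - (2 / (c - a) * ((U c - U b) / (c - b) - (U b - U a) / (b - a))) := by ring
  rw [e] at h2
  rw [abs_le]; constructor <;> linarith

lemma ddiff_sym {x h m D : ℝ} {U U1 U2 : ℝ → ℝ} (hU : C2On (x - h) (x + h) U U1 U2) (hh : 0 < h)
    (hD : ∀ s, 0 ≤ s → s < h → |U2 (x + s) + U2 (x - s) - 2 * m| ≤ 2 * D) :
    |2 / (x + h - (x - h)) * ((U (x + h) - U x) / (x + h - x) - (U x - U (x - h)) / (x - (x - h)))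
      - m| ≤ D := by
  have hG : C2On (-h) h (fun s => (1/2) * (U (x + s) + U (x - s)))
      (fun s => (1/2) * (U1 (x + s) - U1 (x - s)))
      (fun s => (1/2) * (U2 (x + s) + U2 (x - s))) := by
    refine ⟨?_, ?_, ?_⟩
    · apply ContinuousOn.const_mul
      apply ContinuousOn.add
      · exact hU.cont.comp (by fun_prop) (fun s hs => ⟨by linarith [hs.1], by linarith [hs.2]⟩)
      · exact hU.cont.comp (by fun_prop) (fun s hs => ⟨by linarith [hs.2], by linarith [hs.1]⟩)
    · intro s hs
      have a1 := (hU.d1 (x + s) ⟨by linarith [hs.1], by linarith [hs.2]⟩).comp_const_add x s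
      have a2 := (hU.d1 (x - s) ⟨by linarith [hs.2], by linarith [hs.1]⟩).comp_const_sub x s
      exact ((a1.add a2).const_mul (1/2)).congr_deriv (by ring)
    · intro s hs
      have a1 := (hU.d2 (x + s) ⟨by linarith [hs.1], by linarith [hs.2]⟩).comp_const_add x s
      have a2 := (hU.d2 (x - s) ⟨by linarith [hs.2], by linarith [hs.1]⟩).comp_const_sub x s
      exact ((a1.sub a2).const_mul (1/2)).congr_deriv (by ring)
  have := ddiff_bound (b := 0) (m := m) (D := D) hG (by linarith) hh ?_
  · simp only [sub_neg_eq_add, add_zero, sub_zero, ← sub_eq_add_neg] at this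
    convert this using 2
    rw [show x + h - (x - h) = h + h by ring, show x + h - x = h by ring,
      show x - (x - h) = h by ring, zero_add]
    field_simp
    ring
  · intro t ht
    have key : |U2 (x + t) + U2 (x - t) - 2 * m| ≤ 2 * D := by
      rcases le_total 0 t with h0 | h0
      · exact hD t h0 ht.2
      · have := hD (-t) (by linarith) (by linarith [ht.1])
        simp only [sub_neg_eq_add, ← sub_eq_add_neg] at this
        rwa [add_comm (U2 (x + t))]
    rw [abs_le] at key ⊢
    constructor <;> linarith [key.1, key.2]

lemma landau {a b A B δ x : ℝ} {g g1 g2 : ℝ → ℝ} (hg : C2On a b g g1 g2)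
    (hA : ∀ t ∈ Icc a b, |g t| ≤ A) (hB : ∀ t ∈ Ioo a b, |g2 t| ≤ B) (hδ : 0 < δ)
    (hδ2 : 2 * δ < b - a) (hx : x ∈ Ioo a b) : |g1 x| ≤ 2 * A / δ + B * δ := by
  have key : ∃ p q, a ≤ p ∧ p < q ∧ q ≤ b ∧ q - p = δ ∧ p ≤ x ∧ x ≤ q := by
    rcases le_total (x + δ) b with h | h
    · exact ⟨x, x + δ, hx.1.le, by linarith, h, by ring, le_rfl, by linarith⟩
    · exact ⟨x - δ, x, by linarith, by linarith, hx.2.le, by ring, by linarith, le_rfl⟩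
  obtain ⟨p, q, hap, hpq, hqb, hd, hpx, hxq⟩ := key
  obtain ⟨c, hc, hc'⟩ := exists_hasDerivAt_eq_slope g g1 hpq
    (hg.cont.mono (Icc_subset_Icc hap hqb)) (fun t ht => hg.d1 t (Ioo_subset_Ioo hap hqb ht))
  have hcI : c ∈ Ioo a b := Ioo_subset_Ioo hap hqb hc
  have h1 : |g1 c| ≤ 2 * A / δ := by
    rw [hc', hd, abs_div, abs_of_pos hδ]
    gcongr
    have := abs_sub (g q) (g p)
    have := hA q ⟨by linarith, hqb⟩
    have := hA p ⟨hap, by linarith⟩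
    linarith
  have h2 : |g1 x - g1 c| ≤ B * |x - c| := by
    have := Convex.norm_image_sub_le_of_norm_hasDerivWithin_le (f := g1) (f' := g2) (s := Ioo a b)
      (C := B) (fun t ht => (hg.d2 t ht).hasDerivWithinAt) (fun t ht => hB t ht) (convex_Ioo a b)
      hcI hx
    simpa using this
  have hB0 : 0 ≤ B := (abs_nonneg _).trans (hB x hx)
  have h3 : |x - c| ≤ δ := by rw [abs_le]; constructor <;> linarith [hc.1, hc.2]
  have h4 : B * |x - c| ≤ B * δ := by gcongr
  have : g1 x = g1 c + (g1 x - g1 c) := by ring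
  rw [this]
  exact (abs_add_le _ _).trans (by linarith)

lemma max_principle {w w1 w2 : ℝ → ℝ} (hw : C2On 0 1 w w1 w2) (h0 : 0 ≤ w 0) (h1 : 0 ≤ w 1)
    (h : ∀ x ∈ Ioo (0:ℝ) 1, w x < 0 → w2 x < 0) : ∀ x ∈ Icc (0:ℝ) 1, 0 ≤ w x := by
  obtain ⟨x0, hx0, hmin⟩ := isCompact_Icc.exists_isMinOn
    (nonempty_Icc.2 (zero_le_one (α := ℝ))) hw.cont
  by_contra! hcon
  obtain ⟨x, hx, hxn⟩ := hcon
  have hneg : w x0 < 0 := lt_of_le_of_lt (hmin hx) hxn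
  have hI : x0 ∈ Ioo (0:ℝ) 1 := by
    refine ⟨lt_of_le_of_ne hx0.1 ?_, lt_of_le_of_ne hx0.2 ?_⟩
    · rintro rfl; linarith
    · rintro rfl; linarith
  have hloc : IsLocalMin w x0 := hmin.isLocalMin (Icc_mem_nhds hI.1 hI.2)
  have hw1 : w1 x0 = 0 := hloc.hasDerivAt_eq_zero (hw.d1 x0 hI)
  have hev : deriv w =ᶠ[nhds x0] w1 := by
    filter_upwards [Ioo_mem_nhds hI.1 hI.2] with t ht using (hw.d1 t ht).deriv
  have hdd : deriv (deriv w) x0 = w2 x0 := by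
    rw [hev.deriv_eq]; exact (hw.d2 x0 hI).deriv
  have hw2 := h x0 hI hneg
  have hmax : IsLocalMax w x0 := isLocalMax_of_deriv_deriv_neg (by rw [hdd]; exact hw2)
    (by rw [(hw.d1 x0 hI).deriv, hw1]) (hw.d1 x0 hI).continuousAt
  have hcst : w =ᶠ[nhds x0] fun _ => w x0 := by
    filter_upwards [hloc, hmax] with t ht1 ht2 using le_antisymm ht2 ht1
  have : deriv (deriv w) x0 = 0 := by
    rw [hcst.deriv.deriv_eq]; simp
  linarith

/-- layer function -/
def Elay (k x : ℝ) : ℝ := Real.exp (-k * x) + Real.exp (-k * (1 - x))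

lemma Elay_pos (k x : ℝ) : 0 < Elay k x := by unfold Elay; positivity

lemma Elay_le_two {k x : ℝ} (hk : 0 ≤ k) (hx : x ∈ Icc (0:ℝ) 1) : Elay k x ≤ 2 := by
  unfold Elay
  have h1 : Real.exp (-k * x) ≤ 1 := Real.exp_le_one_iff.2 (by nlinarith [hx.1])
  have h2 : Real.exp (-k * (1 - x)) ≤ 1 := Real.exp_le_one_iff.2 (by nlinarith [hx.2])
  linarith

lemma C2On_exp (a b k d : ℝ) : C2On a b (fun x => Real.exp (k * x + d))
    (fun x => k * Real.exp (k * x + d)) (fun x => k ^ 2 * Real.exp (k * x + d)) := by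
  have h : ∀ x, HasDerivAt (fun x => Real.exp (k * x + d)) (k * Real.exp (k * x + d)) x := by
    intro x
    have := (((hasDerivAt_id x).const_mul k).add_const d).exp
    simp only [id] at this
    exact this.congr_deriv (by ring)
  refine ⟨by fun_prop, fun x _ => h x, fun x _ => ?_⟩
  exact ((h x).const_mul k).congr_deriv (by ring)

lemma C2On_left (a b k : ℝ) : C2On a b (fun x => Real.exp (-k * x))
    (fun x => -k * Real.exp (-k * x)) (fun x => k ^ 2 * Real.exp (-k * x)) := by
  simpa using C2On_exp a b (-k) 0

lemma C2On_right (a b k : ℝ) : C2On a b (fun x => Real.exp (-k * (1 - x)))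
    (fun x => k * Real.exp (-k * (1 - x))) (fun x => k ^ 2 * Real.exp (-k * (1 - x))) := by
  have := C2On_exp a b k (-k)
  have e : ∀ x : ℝ, k * x + -k = -k * (1 - x) := fun x => by ring
  simpa only [e] using this

lemma C2On_Elay (a b k : ℝ) : C2On a b (Elay k)
    (fun x => -k * Real.exp (-k * x) + k * Real.exp (-k * (1 - x)))
    (fun x => k ^ 2 * Elay k x) := by
  have := (C2On_left a b k).add (C2On_right a b k)
  refine ⟨this.cont, this.d1, fun x hx => (this.d2 x hx).congr_deriv ?_⟩
  unfold Elay; ring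

lemma barrier {g g1 g2 B B1 B2 a : ℝ → ℝ} {ε : ℝ} (hε : 0 < ε) (hg : C2On 0 1 g g1 g2)
    (hB : C2On 0 1 B B1 B2) (ha : ∀ x ∈ Ioo (0:ℝ) 1, 0 < a x)
    (h : ∀ x ∈ Ioo (0:ℝ) 1, |-ε ^ 2 * g2 x + a x * g x| ≤ -ε ^ 2 * B2 x + a x * B x)
    (h0 : |g 0| ≤ B 0) (h1 : |g 1| ≤ B 1) : ∀ x ∈ Icc (0:ℝ) 1, |g x| ≤ B x := by
  have hε2 : 0 < ε ^ 2 := by positivity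
  have k1 := max_principle (hB.sub hg) (by linarith [(abs_le.1 h0).2])
    (by linarith [(abs_le.1 h1).2]) (by
      intro x hx hn
      have h2 := (abs_le.1 (h x hx)).2
      have h3 := mul_neg_of_pos_of_neg (ha x hx) hn
      by_contra! hc
      have := mul_nonneg hε2.le hc
      linarith)
  have k2 := max_principle (hB.add hg) (by linarith [(abs_le.1 h0).1])
    (by linarith [(abs_le.1 h1).1]) (by
      intro x hx hn
      have h2 := (abs_le.1 (h x hx)).1
      have h3 := mul_neg_of_pos_of_neg (ha x hx) hn
      by_contra! hc
      have := mul_nonneg hε2.le hc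
      linarith)
  intro x hx
  rw [abs_le]
  constructor <;> linarith [k1 x hx, k2 x hx]

/-- the strip -/
def strip : Set (ℝ × ℝ) := (Icc (0:ℝ) 1) ×ˢ (univ : Set ℝ)

lemma uniqueDiffOn_strip : UniqueDiffOn ℝ strip :=
  (uniqueDiffOn_Icc zero_lt_one).prod uniqueDiffOn_univ

lemma fstruct {f : ℝ → ℝ → ℝ} (hf : SmoothF f) :
    ∃ (D1 : ℝ × ℝ → (ℝ × ℝ →L[ℝ] ℝ)) (D2 : ℝ × ℝ → (ℝ × ℝ →L[ℝ] (ℝ × ℝ →L[ℝ] ℝ))),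
      (∀ p ∈ strip, HasFDerivWithinAt (fun p : ℝ × ℝ => f p.1 p.2) (D1 p) strip p) ∧
      (∀ p ∈ strip, HasFDerivWithinAt D1 (D2 p) strip p) ∧
      ∀ l : ℝ, ∃ M : ℝ, 0 < M ∧ ∀ x ∈ Icc (0:ℝ) 1, ∀ y : ℝ, |y| ≤ l →
        |f x y| ≤ M ∧ ‖D1 (x, y)‖ ≤ M ∧ ‖D2 (x, y)‖ ≤ M := by
  have hf0 : ContDiffOn ℝ 4 (fun p : ℝ × ℝ => f p.1 p.2) strip := hf
  have hf1 : ContDiffOn ℝ 3 (fderivWithin ℝ (fun p : ℝ × ℝ => f p.1 p.2) strip) strip :=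
    hf0.fderivWithin uniqueDiffOn_strip (by norm_num)
  have hf2 : ContDiffOn ℝ 2
      (fderivWithin ℝ (fderivWithin ℝ (fun p : ℝ × ℝ => f p.1 p.2) strip) strip) strip :=
    hf1.fderivWithin uniqueDiffOn_strip (by norm_num)
  refine ⟨_, _, fun p hp => ((hf0.differentiableOn (by norm_num)) p hp).hasFDerivWithinAt,
    fun p hp => ((hf1.differentiableOn (by norm_num)) p hp).hasFDerivWithinAt, fun l => ?_⟩
  have hK : IsCompact ((Icc (0:ℝ) 1) ×ˢ (Icc (-l) l)) := isCompact_Icc.prod isCompact_Icc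
  have hsub : (Icc (0:ℝ) 1) ×ˢ (Icc (-l) l) ⊆ strip := prod_mono subset_rfl (subset_univ _)
  obtain ⟨M0, h0⟩ := hK.exists_bound_of_continuousOn (hf0.continuousOn.mono hsub)
  obtain ⟨M1, h1⟩ := hK.exists_bound_of_continuousOn (hf1.continuousOn.mono hsub)
  obtain ⟨M2, h2⟩ := hK.exists_bound_of_continuousOn (E := ℝ × ℝ →L[ℝ] (ℝ × ℝ →L[ℝ] ℝ))
    (hf2.continuousOn.mono hsub)
  refine ⟨max 1 (max M0 (max M1 M2)), by positivity, fun x hx y hy => ?_⟩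
  have hm : (x, y) ∈ (Icc (0:ℝ) 1) ×ˢ (Icc (-l) l) := ⟨hx, abs_le.1 hy⟩
  refine ⟨(h0 _ hm).trans (by simp), (h1 _ hm).trans (by simp), (h2 _ hm).trans (by simp)⟩

lemma partial_u {f : ℝ → ℝ → ℝ} {D : ℝ × ℝ →L[ℝ] ℝ} {x y : ℝ} (hx : x ∈ Icc (0:ℝ) 1)
    (h : HasFDerivWithinAt (fun p : ℝ × ℝ => f p.1 p.2) D strip (x, y)) :
    HasDerivAt (fun z => f x z) (D (0, 1)) y := by
  have h1 : HasDerivAt (fun z : ℝ => (x, z)) ((0:ℝ), (1:ℝ)) y :=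
    (hasDerivAt_const y x).prodMk (hasDerivAt_id y)
  exact h.comp_hasDerivAt (f := fun z : ℝ => (x, z)) y h1
    (Filter.Eventually.of_forall fun z => ⟨hx, mem_univ _⟩)

lemma f_mono {f : ℝ → ℝ → ℝ} {c₀ : ℝ} (hf : SmoothF f) (hfu : LowerF f c₀) {x : ℝ}
    (hx : x ∈ Icc (0:ℝ) 1) {a b : ℝ} (hab : a ≤ b) : c₀ ^ 2 * (b - a) ≤ f x b - f x a := by
  obtain ⟨D1, D2, h1, -, -⟩ := fstruct hf
  refine mul_sub_le_image_sub_of_le_deriv (f := fun z => f x z) ?_ (fun y => hfu x hx y) hab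
  exact fun y => (partial_u hx (h1 (x, y) ⟨hx, mem_univ _⟩)).differentiableAt

lemma sol_reg {f : ℝ → ℝ → ℝ} {ε : ℝ} (hε : 0 < ε) {u : ℝ → ℝ} (hu : IsSolution f ε u) :
    ∃ u1 : ℝ → ℝ, ContinuousOn u1 (Icc 0 1) ∧ C2On 0 1 u u1 (fun x => f x (u x) / ε ^ 2) := by
  obtain ⟨hC, hode, -, -⟩ := hu
  have hU : UniqueDiffOn ℝ (Icc (0:ℝ) 1) := uniqueDiffOn_Icc zero_lt_one
  have h1 : ContDiffOn ℝ 3 (derivWithin u (Icc (0:ℝ) 1)) (Icc 0 1) :=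
    hC.derivWithin hU (by norm_num)
  refine ⟨derivWithin u (Icc (0:ℝ) 1), h1.continuousOn, hC.continuousOn, fun x hx => ?_,
    fun x hx => ?_⟩
  · exact ((hC.differentiableOn (by norm_num)) x (Ioo_subset_Icc_self hx)).hasDerivWithinAt.hasDerivAt
      (Icc_mem_nhds hx.1 hx.2)
  · have h2 := ((h1.differentiableOn (by norm_num)) x
      (Ioo_subset_Icc_self hx)).hasDerivWithinAt.hasDerivAt (Icc_mem_nhds hx.1 hx.2)
    refine h2.congr_deriv ?_
    have h3 := hode x hx
    rw [iteratedDerivWithin_succ, iteratedDerivWithin_one] at h3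
    have : ε ^ 2 ≠ 0 := by positivity
    field_simp
    linarith

lemma sol_bound {f : ℝ → ℝ → ℝ} {c₀ M0 : ℝ} (hc₀ : 0 < c₀) (hf : SmoothF f)
    (hfu : LowerF f c₀) (hM0 : ∀ x ∈ Icc (0:ℝ) 1, |f x 0| ≤ M0) {ε : ℝ} (hε : 0 < ε)
    {u : ℝ → ℝ} (hu : IsSolution f ε u) : ∀ x ∈ Icc (0:ℝ) 1, |u x| ≤ M0 / c₀ ^ 2 := by
  obtain ⟨u1, -, hU⟩ := sol_reg hε hu
  have hM : 0 ≤ M0 := (abs_nonneg _).trans (hM0 0 (by simp))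
  have hl : 0 ≤ M0 / c₀ ^ 2 := by positivity
  have hcl : c₀ ^ 2 * (M0 / c₀ ^ 2) = M0 := by field_simp
  have hε2 : 0 < ε ^ 2 := by positivity
  have hcc : 0 < c₀ ^ 2 := by positivity
  have k1 := max_principle ((C2On.const (M0 / c₀ ^ 2)).sub hU) (by rw [hu.2.2.1]; linarith)
    (by rw [hu.2.2.2]; linarith) (by
      intro x hx hn
      have hx' := Ioo_subset_Icc_self hx
      have := f_mono hf hfu hx' (show 0 ≤ u x by linarith)
      have h2 := (abs_le.1 (hM0 x hx')).1
      have : c₀ ^ 2 * (M0 / c₀ ^ 2) < c₀ ^ 2 * u x := by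
        apply mul_lt_mul_of_pos_left _ hcc; linarith
      have : 0 < f x (u x) / ε ^ 2 := div_pos (by linarith) hε2
      linarith)
  have k2 := max_principle ((C2On.const (M0 / c₀ ^ 2)).add hU) (by rw [hu.2.2.1]; linarith)
    (by rw [hu.2.2.2]; linarith) (by
      intro x hx hn
      have hx' := Ioo_subset_Icc_self hx
      have := f_mono hf hfu hx' (show u x ≤ 0 by linarith)
      have h2 := (abs_le.1 (hM0 x hx')).2
      have : c₀ ^ 2 * (M0 / c₀ ^ 2) < c₀ ^ 2 * (- u x) := by
        apply mul_lt_mul_of_pos_left _ hcc; linarith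
      have : f x (u x) / ε ^ 2 < 0 := div_neg_of_neg_of_pos (by linarith) hε2
      linarith)
  intro x hx
  rw [abs_le]
  constructor <;> linarith [k1 x hx, k2 x hx]

set_option maxHeartbeats 2000000 in
lemma solution_bounds {f : ℝ → ℝ → ℝ} {c₀ : ℝ} (hc₀ : 0 < c₀) (hf : SmoothF f)
    (hfu : LowerF f c₀) : ∃ K : ℝ, 0 < K ∧ ∀ ε ∈ Ioc (0:ℝ) 1, ∀ u : ℝ → ℝ, IsSolution f ε u →
      ∃ u1 p1 p2 : ℝ → ℝ, C2On 0 1 u u1 (fun x => f x (u x) / ε ^ 2) ∧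
        C2On 0 1 (fun x => f x (u x)) p1 p2 ∧
        (∀ x ∈ Icc (0:ℝ) 1, |f x (u x)| ≤ K * (ε ^ 2 + Elay (c₀ / ε) x)) ∧
        (∀ x ∈ Ioo (0:ℝ) 1, |p2 x| ≤ K * (1 + Elay (c₀ / ε) x / ε ^ 2)) := by
  obtain ⟨D1, D2, hD1, hD2, hbd⟩ := fstruct hf
  obtain ⟨M0, hM0, hM0'⟩ := hbd 0
  set l := M0 / c₀ ^ 2 with hl
  have hl0 : 0 < l := by positivity
  obtain ⟨M, hM, hM'⟩ := hbd l
  set A := 8 * l + M with hA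
  have hA0 : 0 < A := by positivity
  set K1 := M / c₀ ^ 2 + A with hK1
  have hK10 : 0 < K1 := by positivity
  set K2 := 2 * M * (1 + K1) ^ 2 with hK2
  have hK20 : 0 < K2 := by positivity
  set K3 := K2 / c₀ ^ 2 + 2 * K2 / (3 * c₀ ^ 2) + M with hK3
  have hK30 : 0 < K3 := by positivity
  refine ⟨K3 + (2 * K2 + M * K3), by positivity, ?_⟩
  rintro ε ⟨hε, hε1⟩ u hu
  have hε2 : 0 < ε ^ 2 := by positivity
  have hcc : 0 < c₀ ^ 2 := by positivity
  set k := c₀ / ε with hk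
  have hk0 : 0 < k := by positivity
  have hek : ε ^ 2 * k ^ 2 = c₀ ^ 2 := by rw [hk]; field_simp
  obtain ⟨u1, hu1c, hU⟩ := sol_reg hε hu
  have hub := sol_bound hc₀ hf hfu (fun x hx => (hM0' x hx 0 (by simp)).1) hε hu
  have hmem : ∀ x ∈ Icc (0:ℝ) 1, (x, u x) ∈ strip := fun x hx => ⟨hx, mem_univ _⟩
  have hbound : ∀ x ∈ Icc (0:ℝ) 1, |f x (u x)| ≤ M ∧ ‖D1 (x, u x)‖ ≤ M ∧ ‖D2 (x, u x)‖ ≤ M :=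
    fun x hx => hM' x hx (u x) (hub x hx)
  -- the curve
  have hcurve : ∀ x ∈ Ioo (0:ℝ) 1, HasDerivAt (fun t => (t, u t)) ((1:ℝ), u1 x) x :=
    fun x hx => (hasDerivAt_id x).prodMk (hU.d1 x hx)
  have hevs : ∀ x ∈ Ioo (0:ℝ) 1, ∀ᶠ t in nhds x, (t, u t) ∈ strip := fun x hx => by
    filter_upwards [Icc_mem_nhds hx.1 hx.2] with t ht using hmem t ht
  set p1 : ℝ → ℝ := fun x => D1 (x, u x) (1, u1 x) with hp1
  set R : ℝ → ℝ := fun x => D2 (x, u x) (1, u1 x) (1, u1 x) with hR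
  set a : ℝ → ℝ := fun x => D1 (x, u x) (0, 1) with ha
  set p2 : ℝ → ℝ := fun x => R x + a x * (f x (u x) / ε ^ 2) with hp2
  have hP : C2On 0 1 (fun x => f x (u x)) p1 p2 := by
    refine ⟨?_, fun x hx => ?_, fun x hx => ?_⟩
    · have hFc : ContinuousOn (fun p : ℝ × ℝ => f p.1 p.2) strip := fun p hp =>
        (hD1 p hp).continuousWithinAt
      exact hFc.comp (f := fun x => (x, u x)) (continuousOn_id.prodMk hU.cont) hmem
    · exact (hD1 _ (hmem x (Ioo_subset_Icc_self hx))).comp_hasDerivAt (f := fun t => (t, u t)) x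
        (hcurve x hx) (hevs x hx)
    · have e1 := (hD2 _ (hmem x (Ioo_subset_Icc_self hx))).comp_hasDerivAt
        (f := fun t => (t, u t)) x (hcurve x hx) (hevs x hx)
      have e2 : HasDerivAt (fun t => ((1:ℝ), u1 t)) ((0:ℝ), f x (u x) / ε ^ 2) x :=
        (hasDerivAt_const x 1).prodMk (hU.d2 x hx)
      refine (e1.clm_apply e2).congr_deriv ?_
      simp only [hp2, hR, ha, Function.comp]
      congr 1
      rw [show ((0:ℝ), f x (u x) / ε ^ 2) = (f x (u x) / ε ^ 2) • ((0:ℝ), (1:ℝ)) by simp,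
        map_smul, smul_eq_mul, mul_comm]
  have ha_ge : ∀ x ∈ Icc (0:ℝ) 1, c₀ ^ 2 ≤ a x := fun x hx => by
    have := hfu x hx (u x)
    rwa [pderiv1, (partial_u hx (hD1 _ (hmem x hx))).deriv] at this
  have ha_le : ∀ x ∈ Icc (0:ℝ) 1, a x ≤ M := fun x hx => by
    have h1 := (D1 (x, u x)).le_opNorm ((0:ℝ), (1:ℝ))
    have h2 : ‖((0:ℝ), (1:ℝ))‖ = 1 := by simp [Prod.norm_def]
    rw [h2, mul_one] at h1
    exact (le_abs_self _).trans (h1.trans (hbound x hx).2.1)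
  have ha_pos : ∀ x ∈ Ioo (0:ℝ) 1, 0 < a x := fun x hx =>
    hcc.trans_le (ha_ge x (Ioo_subset_Icc_self hx))
  have hp1a : ∀ x, p1 x = D1 (x, u x) (1, 0) + a x * u1 x := fun x => by
    simp only [hp1, ha]
    rw [show ((1:ℝ), u1 x) = (1, 0) + u1 x • ((0:ℝ), (1:ℝ)) by simp, map_add, map_smul,
      smul_eq_mul, mul_comm (u1 x)]
  have hfx : ∀ x ∈ Icc (0:ℝ) 1, |D1 (x, u x) (1, 0)| ≤ M := fun x hx => by
    have h1 := (D1 (x, u x)).le_opNorm ((1:ℝ), (0:ℝ))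
    have h2 : ‖((1:ℝ), (0:ℝ))‖ = 1 := by simp [Prod.norm_def]
    rw [h2, mul_one] at h1
    exact h1.trans (hbound x hx).2.1
  -- crude bound on u1
  have hu1I : ∀ x ∈ Ioo (0:ℝ) 1, |u1 x| ≤ A / ε := fun x hx => by
    have := landau (A := l) (B := M / ε ^ 2) (δ := ε / 4) hU hub (fun t ht => by
      rw [abs_div, abs_of_pos hε2]
      gcongr
      exact (hbound t (Ioo_subset_Icc_self ht)).1) (by positivity) (by linarith) hx
    refine this.trans ?_
    have e : 2 * l / (ε / 4) + M / ε ^ 2 * (ε / 4) = (8 * l + M / 4) / ε := by field_simp; ring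
    rw [e, hA]
    gcongr
    linarith
  have hu1b : ∀ x ∈ Icc (0:ℝ) 1, |u1 x| ≤ A / ε := by
    have hcl : closure (Ioo (0:ℝ) 1) = Icc 0 1 := closure_Ioo (by norm_num)
    intro x hx
    rw [← hcl] at hx hu1c
    exact le_on_closure (f := fun x => |u1 x|) (g := fun _ => A / ε) hu1I hu1c.abs
      continuousOn_const hx
  -- endpoints of E
  have hE0 : 1 ≤ Elay k 0 := by
    unfold Elay; simp; positivity
  have hE1 : 1 ≤ Elay k 1 := by
    unfold Elay; simp; positivity
  -- refined bound on u1
  have hZ : C2On 0 1 u1 (fun x => f x (u x) / ε ^ 2) (fun x => p1 x / ε ^ 2) :=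
    ⟨hu1c, hU.d2, fun x hx => (hP.d1 x hx).div_const _⟩
  have hu1r : ∀ x ∈ Icc (0:ℝ) 1, |u1 x| ≤ M / c₀ ^ 2 + A / ε * Elay k x := by
    refine barrier hε hZ ((C2On.const (M / c₀ ^ 2)).add ((C2On_Elay 0 1 k).cmul (A / ε))) ha_pos
      ?_ ?_ ?_
    · intro x hx
      have hx' := Ioo_subset_Icc_self hx
      have e1 : -ε ^ 2 * (p1 x / ε ^ 2) + a x * u1 x = - D1 (x, u x) (1, 0) := by
        rw [hp1a]; field_simp; ring
      rw [e1, abs_neg]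
      refine (hfx x hx').trans ?_
      have h1 := ha_ge x hx'
      have h2 : M ≤ a x * (M / c₀ ^ 2) := by
        have : M = c₀ ^ 2 * (M / c₀ ^ 2) := by field_simp
        calc M = c₀ ^ 2 * (M / c₀ ^ 2) := this
          _ ≤ _ := by gcongr
      have h3 : 0 ≤ (a x - c₀ ^ 2) * (A / ε * Elay k x) :=
        mul_nonneg (by linarith) (mul_nonneg (by positivity) (Elay_pos _ _).le)
      have h4 : -ε ^ 2 * (0 + A / ε * (k ^ 2 * Elay k x)) = - (c₀ ^ 2 * (A / ε * Elay k x)) := by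
        rw [← hek]; ring
      rw [h4]
      linarith
    · have := hu1b 0 (by simp)
      have h2 : A / ε * 1 ≤ A / ε * Elay k 0 := by gcongr
      have : 0 < M / c₀ ^ 2 := by positivity
      linarith
    · have := hu1b 1 (by simp)
      have h2 : A / ε * 1 ≤ A / ε * Elay k 1 := by gcongr
      have : 0 < M / c₀ ^ 2 := by positivity
      linarith
  -- bound on R
  have hRb : ∀ x ∈ Icc (0:ℝ) 1, |R x| ≤ K2 * (1 + Elay k x ^ 2 / ε ^ 2) := by
    intro x hx
    have hEp := Elay_pos k x
    set e := Elay k x / ε with he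
    have he0 : 0 < e := by positivity
    have hn : ‖((1:ℝ), u1 x)‖ ≤ (1 + K1) * (1 + e) := by
      rw [Prod.norm_def]
      simp only [norm_one, Real.norm_eq_abs]
      have h1 := hu1r x hx
      have h2 : A / ε * Elay k x = A * e := by rw [he]; ring
      rw [h2] at h1
      have h3 : 0 < M / c₀ ^ 2 := by positivity
      apply max_le
      · nlinarith [mul_pos hK10 he0]
      · rw [hK1]
        nlinarith [mul_pos hA0 he0, mul_pos h3 he0]
    have h1 : |R x| ≤ M * ((1 + K1) * (1 + e)) * ((1 + K1) * (1 + e)) := by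
      have := (D2 (x, u x)).le_opNorm₂ ((1:ℝ), u1 x) ((1:ℝ), u1 x)
      refine (show |R x| ≤ _ from this).trans ?_
      have := (hbound x hx).2.2
      gcongr
    refine h1.trans ?_
    have h2 : Elay k x ^ 2 / ε ^ 2 = e ^ 2 := by rw [he]; ring
    rw [h2, hK2]
    have : 0 ≤ M * (1 + K1) ^ 2 * (1 - e) ^ 2 := by positivity
    linarith
  -- bound on φ
  have hφ : ∀ x ∈ Icc (0:ℝ) 1, |f x (u x)| ≤ K3 * (ε ^ 2 + Elay k x) := by
    have hb := barrier hε hP (((C2On.const (K2 * ε ^ 2 / c₀ ^ 2)).add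
      ((((C2On_left 0 1 k).sub (C2On_left 0 1 (2 * k))).add
        ((C2On_right 0 1 k).sub (C2On_right 0 1 (2 * k)))).cmul (2 * K2 / (3 * c₀ ^ 2)))).add
        ((C2On_Elay 0 1 k).cmul M)) ha_pos ?_ ?_ ?_
    · intro x hx
      have hp0 : 0 < Real.exp (-(2 * k) * x) := Real.exp_pos _
      have hq0 : 0 < Real.exp (-(2 * k) * (1 - x)) := Real.exp_pos _
      have h2 : 0 ≤ 2 * K2 / (3 * c₀ ^ 2) := by positivity
      have h3 : 0 ≤ K2 / c₀ ^ 2 := by positivity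
      have h4 : 0 < Elay k x := Elay_pos k x
      refine (hb x hx).trans ?_
      have e1 : K2 * ε ^ 2 / c₀ ^ 2 = K2 / c₀ ^ 2 * ε ^ 2 := by ring
      have h5 : 2 * K2 / (3 * c₀ ^ 2) * (Real.exp (-k * x) - Real.exp (-(2 * k) * x) +
          (Real.exp (-k * (1 - x)) - Real.exp (-(2 * k) * (1 - x))))
          ≤ 2 * K2 / (3 * c₀ ^ 2) * Elay k x := by
        unfold Elay
        gcongr <;> linarith
      rw [e1, hK3]
      have h6 := mul_nonneg h3 h4.le
      have h7 := mul_nonneg h2 hε2.le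
      have h8 := mul_nonneg hM.le hε2.le
      linarith
    · intro x hx
      have hx' := Ioo_subset_Icc_self hx
      have h1 := ha_ge x hx'
      have e1 : -ε ^ 2 * p2 x + a x * f x (u x) = - (ε ^ 2 * R x) := by
        simp only [hp2]; field_simp; ring
      rw [e1, abs_neg, abs_mul, abs_of_pos hε2]
      set p := Real.exp (-k * x) with hp
      set q := Real.exp (-k * (1 - x)) with hq
      have hpp : Real.exp (-(2 * k) * x) = p ^ 2 := by
        rw [hp, ← Real.exp_nat_mul]; congr 1; push_cast; ring
      have hqq : Real.exp (-(2 * k) * (1 - x)) = q ^ 2 := by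
        rw [hq, ← Real.exp_nat_mul]; congr 1; push_cast; ring
      have hE : Elay k x = p + q := rfl
      have hp0 : 0 < p := Real.exp_pos _
      have hq0 : 0 < q := Real.exp_pos _
      have hp1 : p ≤ 1 := Real.exp_le_one_iff.2 (by nlinarith [hx.1])
      have hq1 : q ≤ 1 := Real.exp_le_one_iff.2 (by nlinarith [hx.2])
      rw [hpp, hqq, hE]
      have h2 : ε ^ 2 * |R x| ≤ K2 * (ε ^ 2 + (p + q) ^ 2) := by
        have := hRb x hx'
        rw [hE] at this
        calc ε ^ 2 * |R x| ≤ ε ^ 2 * (K2 * (1 + (p + q) ^ 2 / ε ^ 2)) := by gcongr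
          _ = _ := by field_simp
      refine h2.trans ?_
      have e2 : -ε ^ 2 * (0 + 2 * K2 / (3 * c₀ ^ 2) * (k ^ 2 * p - (2 * k) ^ 2 * p ^ 2 +
          (k ^ 2 * q - (2 * k) ^ 2 * q ^ 2)) + M * (k ^ 2 * (p + q)))
        = 2 * K2 / (3 * c₀ ^ 2) * (- c₀ ^ 2 * (p - 4 * p ^ 2 + (q - 4 * q ^ 2)))
          - c₀ ^ 2 * (M * (p + q)) := by rw [← hek]; ring
      rw [e2]
      have h3 : 0 ≤ 2 * K2 / (3 * c₀ ^ 2) := by positivity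
      have g1 : K2 * ε ^ 2 ≤ a x * (K2 * ε ^ 2 / c₀ ^ 2) := by
        calc K2 * ε ^ 2 = c₀ ^ 2 * (K2 * ε ^ 2 / c₀ ^ 2) := by field_simp
          _ ≤ _ := by gcongr
      have g2 : 0 ≤ (a x - c₀ ^ 2) * (M * (p + q)) :=
        mul_nonneg (by linarith) (by positivity)
      have g3 : 0 ≤ (a x - c₀ ^ 2) * (2 * K2 / (3 * c₀ ^ 2) * (p - p ^ 2 + (q - q ^ 2))) :=
        mul_nonneg (by linarith) (mul_nonneg h3 (by nlinarith))
      have g4 : 2 * K2 / (3 * c₀ ^ 2) * (3 * c₀ ^ 2 * (p ^ 2 + q ^ 2))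
          = 2 * K2 * (p ^ 2 + q ^ 2) := by field_simp
      have g5 : 0 ≤ K2 * (p - q) ^ 2 := by positivity
      linarith
    · have h2 : M * 1 ≤ M * Elay k 0 := by gcongr
      have h3 : 0 ≤ K2 * ε ^ 2 / c₀ ^ 2 := by positivity
      have h4 := (hbound 0 (by simp)).1
      have h5 : Real.exp (-(2 * k)) ≤ Real.exp (-k) := Real.exp_le_exp.2 (by linarith)
      have h6 : 0 ≤ 2 * K2 / (3 * c₀ ^ 2) * (Real.exp (-k * 0) - Real.exp (-(2 * k) * 0) +
          (Real.exp (-k * (1 - 0)) - Real.exp (-(2 * k) * (1 - 0)))) := by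
        apply mul_nonneg (by positivity)
        simp only [mul_zero, sub_zero, mul_one]
        linarith
      linarith
    · have h2 : M * 1 ≤ M * Elay k 1 := by gcongr
      have h3 : 0 ≤ K2 * ε ^ 2 / c₀ ^ 2 := by positivity
      have h4 := (hbound 1 (by simp)).1
      have h5 : Real.exp (-(2 * k)) ≤ Real.exp (-k) := Real.exp_le_exp.2 (by linarith)
      have h6 : 0 ≤ 2 * K2 / (3 * c₀ ^ 2) * (Real.exp (-k * 1) - Real.exp (-(2 * k) * 1) +
          (Real.exp (-k * (1 - 1)) - Real.exp (-(2 * k) * (1 - 1)))) := by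
        apply mul_nonneg (by positivity)
        simp only [mul_zero, sub_self, mul_one]
        linarith
      linarith
  refine ⟨u1, p1, p2, hU, hP, fun x hx => ?_, fun x hx => ?_⟩
  · refine (hφ x hx).trans ?_
    have := Elay_pos k x
    have h1 : 0 ≤ (2 * K2 + M * K3) * (ε ^ 2 + Elay k x) := by positivity
    linarith
  · have hx' := Ioo_subset_Icc_self hx
    have hEp := Elay_pos k x
    have hE2 := Elay_le_two hk0.le hx'
    have h1 := hRb x hx'
    have h2 : |a x * (f x (u x) / ε ^ 2)| ≤ M * (K3 * (1 + Elay k x / ε ^ 2)) := by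
      rw [abs_mul, abs_of_pos (ha_pos x hx), abs_div, abs_of_pos hε2]
      have h3 : |f x (u x)| / ε ^ 2 ≤ K3 * (1 + Elay k x / ε ^ 2) := by
        rw [div_le_iff₀ hε2]
        refine (hφ x hx').trans (le_of_eq ?_)
        field_simp
      have := ha_le x hx'
      gcongr
    have h4 : Elay k x ^ 2 / ε ^ 2 ≤ 2 * (Elay k x / ε ^ 2) := by
      rw [← mul_div_assoc]
      gcongr
      nlinarith
    have h5 : |p2 x| ≤ |R x| + |a x * (f x (u x) / ε ^ 2)| := abs_add_le _ _
    have h6 : K2 * (1 + Elay k x ^ 2 / ε ^ 2) ≤ K2 * (1 + 2 * (Elay k x / ε ^ 2)) := by gcongr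
    have h7 : 0 ≤ Elay k x / ε ^ 2 := by positivity
    have h8 := mul_nonneg hK30.le h7
    linarith

/-- a-priori information on the solution -/
structure SolB (c₀ K ε : ℝ) (u u1 p p1 p2 : ℝ → ℝ) : Prop where
  hU : C2On 0 1 u u1 (fun x => p x / ε ^ 2)
  hP : C2On 0 1 p p1 p2
  bp : ∀ x ∈ Icc (0:ℝ) 1, |p x| ≤ K * (ε ^ 2 + Elay (c₀ / ε) x)
  bp2 : ∀ x ∈ Ioo (0:ℝ) 1, |p2 x| ≤ K * (1 + Elay (c₀ / ε) x / ε ^ 2)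

section est
variable {c₀ K ε : ℝ} {u u1 p p1 p2 : ℝ → ℝ}

lemma SolB.bu2 (hS : SolB c₀ K ε u u1 p p1 p2) (hε : 0 < ε) : ∀ x ∈ Ioo (0:ℝ) 1,
    |p x / ε ^ 2| ≤ K * (1 + Elay (c₀ / ε) x / ε ^ 2) := by
  intro x hx
  have hε2 : 0 < ε ^ 2 := by positivity
  rw [abs_div, abs_of_pos hε2, div_le_iff₀ hε2]
  refine (hS.bp x (Ioo_subset_Icc_self hx)).trans (le_of_eq ?_)
  field_simp

lemma rhs_fine (hc₀ : 0 < c₀) (hK : 0 < K) (hε : 0 < ε) (hε1 : ε ≤ 1) {x : ℝ}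
    (hx : x ∈ Ioo (0:ℝ) 1) : K * (1 + Elay (c₀ / ε) x / ε ^ 2) ≤ 3 * K / ε ^ 2 * 1 := by
  have hE := Elay_le_two (show 0 ≤ c₀ / ε by positivity) (Ioo_subset_Icc_self hx)
  have : 1 ≤ 1 / ε ^ 2 := by
    rw [le_div_iff₀ (by positivity)]; nlinarith
  calc K * (1 + Elay (c₀ / ε) x / ε ^ 2) ≤ K * (1 / ε ^ 2 + 2 / ε ^ 2) := by gcongr
    _ = _ := by ring

lemma C2On_Qc (a b : ℝ) (hc₀ : 0 < c₀) (hε : 0 < ε) :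
    C2On a b (fun t => K * (t ^ 2 / 2 + (c₀ ^ 2)⁻¹ * Elay (c₀ / ε) t))
      (fun t => K * (t + (c₀ ^ 2)⁻¹ * (-(c₀ / ε) * Real.exp (-(c₀ / ε) * t)
        + (c₀ / ε) * Real.exp (-(c₀ / ε) * (1 - t)))))
      (fun t => K * (1 + Elay (c₀ / ε) t / ε ^ 2)) := by
  have h := (C2On.sq.add ((C2On_Elay a b (c₀ / ε)).cmul (c₀ ^ 2)⁻¹)).cmul K
  refine ⟨h.cont, h.d1, fun x hx => (h.d2 x hx).congr_deriv ?_⟩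
  field_simp

lemma eps_dd (hU : C2On 0 1 u u1 (fun x => p x / ε ^ 2)) (hε : 0 < ε) :
    C2On 0 1 (fun x => ε ^ 2 * u x) (fun x => ε ^ 2 * u1 x) p := by
  have := hU.cmul (ε ^ 2)
  refine ⟨this.cont, this.d1, fun x hx => (this.d2 x hx).congr_deriv ?_⟩
  field_simp

lemma dd_scale (s a b c A B C : ℝ) :
    2 / (c - a) * ((s * C - s * B) / (c - b) - (s * B - s * A) / (b - a))
      = s * (2 / (c - a) * ((C - B) / (c - b) - (B - A) / (b - a))) := by
  ring

lemma trunc_fine (hS : SolB c₀ K ε u u1 p p1 p2) (hc₀ : 0 < c₀) (hK : 0 < K) (hε : 0 < ε)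
    (hε1 : ε ≤ 1) {a x c h : ℝ} (hh : 0 < h) (ha : a = x - h) (hc : c = x + h) (ha0 : 0 ≤ a)
    (hc1 : c ≤ 1) :
    |ε ^ 2 * (2 / (c - a) * ((u c - u x) / (c - x) - (u x - u a) / (x - a))) - p x|
      ≤ 3 * K / 2 * (h / ε) ^ 2 := by
  subst ha hc
  rw [← dd_scale]
  refine ddiff_sym ((eps_dd hS.hU hε).mono ha0 hc1) hh (fun s hs hsh => ?_)
  have := second_diff_bound (x := x) (s := s) hS.hP (C2On.sq.cmul (3 * K / ε ^ 2))
    (fun t ht => (hS.bp2 t ht).trans (rhs_fine hc₀ hK hε hε1 ht)) hs (by linarith) (by linarith)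
  refine this.trans ?_
  have e1 : 3 * K / ε ^ 2 * ((x + s) ^ 2 / 2) + 3 * K / ε ^ 2 * ((x - s) ^ 2 / 2)
    - 2 * (3 * K / ε ^ 2 * (x ^ 2 / 2)) = 3 * K / ε ^ 2 * s ^ 2 := by ring
  have e2 : 2 * (3 * K / 2 * (h / ε) ^ 2) = 3 * K / ε ^ 2 * h ^ 2 := by ring
  rw [e1, e2]
  gcongr

lemma trunc_coarse (hS : SolB c₀ K ε u u1 p p1 p2) (hc₀ : 0 < c₀) (hK : 0 < K) (hε : 0 < ε)
    {a x c h e : ℝ} (hh : 0 < h) (ha : a = x - h) (hc : c = x + h) (ha0 : 0 ≤ a)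
    (hc1 : c ≤ 1) (he : ∀ t ∈ Icc a c, Elay (c₀ / ε) t ≤ e) :
    |ε ^ 2 * (2 / (c - a) * ((u c - u x) / (c - x) - (u x - u a) / (x - a))) - p x|
      ≤ K / 2 * (h ^ 2 + 2 * (c₀ ^ 2)⁻¹ * e) := by
  subst ha hc
  rw [← dd_scale]
  refine ddiff_sym ((eps_dd hS.hU hε).mono ha0 hc1) hh (fun s hs hsh => ?_)
  have := second_diff_bound (x := x) (s := s) hS.hP (C2On_Qc 0 1 hc₀ hε)
    hS.bp2 hs (by linarith) (by linarith)
  refine this.trans ?_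
  have e1 := he (x + s) ⟨by linarith, by linarith⟩
  have e2 := he (x - s) ⟨by linarith, by linarith⟩
  have e3 := Elay_pos (c₀ / ε) x
  have h1 : s ^ 2 ≤ h ^ 2 := by gcongr
  have hci : 0 < (c₀ ^ 2)⁻¹ := by positivity
  have h2 : K * (s ^ 2 + (c₀ ^ 2)⁻¹ * (Elay (c₀ / ε) (x + s) + Elay (c₀ / ε) (x - s)
      - 2 * Elay (c₀ / ε) x)) ≤ K * (h ^ 2 + (c₀ ^ 2)⁻¹ * (2 * e)) := by
    gcongr; linarith
  linarith

lemma trunc_trans1 (hS : SolB c₀ K ε u u1 p p1 p2) (hK : 0 < K) (hε : 0 < ε)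
    {a x c e : ℝ} (hax : a < x) (hxc : x < c) (ha0 : 0 ≤ a)
    (hc1 : c ≤ 1) (he : ∀ t ∈ Icc a c, Elay (c₀ / ε) t ≤ e) :
    |ε ^ 2 * (2 / (c - a) * ((u c - u x) / (c - x) - (u x - u a) / (x - a))) - p x|
      ≤ 2 * (K * (ε ^ 2 + e)) := by
  rw [← dd_scale]
  have hb : ∀ t ∈ Icc a c, |p t| ≤ K * (ε ^ 2 + e) := fun t ht => by
    refine (hS.bp t ⟨by linarith [ht.1], by linarith [ht.2]⟩).trans ?_
    have := he t ht
    gcongr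
  refine ddiff_bound ((eps_dd hS.hU hε).mono ha0 hc1) hax hxc (fun t ht => ?_)
  have h1 := hb t (Ioo_subset_Icc_self ht)
  have h2 := hb x ⟨hax.le, hxc.le⟩
  exact (abs_sub _ _).trans (by linarith)

lemma trunc_trans2 (hS : SolB c₀ K ε u u1 p p1 p2) (hK : 0 < K) (hε : 0 < ε) (hε1 : ε ≤ 1)
    {A B a x c e C r : ℝ} (hA : 0 ≤ A) (hB : B ≤ 1) (hAB : 1 / 2 ≤ B - A) (hAa : A ≤ a)
    (hcB : c ≤ B) (hax : a < x) (hxc : x < c) (hr1 : x - a ≤ r) (hr2 : c - x ≤ r)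
    (he : ∀ t ∈ Icc A B, Elay (c₀ / ε) t ≤ e) (heC : e ≤ C * ε ^ 2) :
    |ε ^ 2 * (2 / (c - a) * ((u c - u x) / (c - x) - (u x - u a) / (x - a))) - p x|
      ≤ 17 * K * (1 + C) * ε * r := by
  have hε2 : 0 < ε ^ 2 := by positivity
  have hC : 0 ≤ C := by
    have h1 := he A ⟨le_rfl, by linarith⟩
    have h2 := Elay_pos (c₀ / ε) A
    by_contra! hc
    have := mul_neg_of_neg_of_pos hc hε2
    linarith
  have hp1 : ∀ t ∈ Ioo A B, |p1 t| ≤ 17 * K * (1 + C) * ε := fun t ht => by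
    have := landau (A := K * (1 + C) * ε ^ 2) (B := K * (1 + C)) (δ := ε / 8)
      (hS.hP.mono hA hB) (fun t ht => by
        refine (hS.bp t ⟨by linarith [ht.1], by linarith [ht.2]⟩).trans ?_
        rw [mul_assoc]
        gcongr
        linarith [he t ht]) (fun t ht => by
        refine (hS.bp2 t ⟨by linarith [ht.1], by linarith [ht.2]⟩).trans ?_
        gcongr
        rw [div_le_iff₀ hε2]
        linarith [he t (Ioo_subset_Icc_self ht)]) (by positivity) (by linarith) ht
    refine this.trans ?_
    have e1 : 2 * (K * (1 + C) * ε ^ 2) / (ε / 8) + K * (1 + C) * (ε / 8)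
      = (16 + 1 / 8) * (K * (1 + C) * ε) := by field_simp; ring
    rw [e1]
    have : 0 ≤ K * (1 + C) * ε := by positivity
    linarith
  rw [← dd_scale]
  refine ddiff_bound ((eps_dd hS.hU hε).mono (by linarith) (by linarith)) hax hxc
    (fun t ht => ?_)
  have := Convex.norm_image_sub_le_of_norm_hasDerivWithin_le (f := p) (f' := p1) (s := Ioo A B)
      (C := 17 * K * (1 + C) * ε)
      (fun t ht => (hS.hP.d1 t ⟨by linarith [ht.1], by linarith [ht.2]⟩).hasDerivWithinAt)
      (fun t ht => hp1 t ht) (convex_Ioo A B)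
      (show x ∈ Ioo A B from ⟨by linarith, by linarith⟩)
      (show t ∈ Ioo A B from ⟨by linarith [ht.1], by linarith [ht.2]⟩)
  simp only [Real.norm_eq_abs] at this
  refine this.trans ?_
  gcongr
  rw [abs_le]
  constructor <;> linarith [ht.1, ht.2]

lemma interp_fine (hS : SolB c₀ K ε u u1 p p1 p2) (hc₀ : 0 < c₀) (hK : 0 < K) (hε : 0 < ε)
    (hε1 : ε ≤ 1) {a b t h : ℝ} (hh : 0 < h) (hb : b = a + h) (ha0 : 0 ≤ a) (hb1 : b ≤ 1)
    (ht : t ∈ Icc a b) :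
    |u a + (u b - u a) * (t - a) / (b - a) - u t| ≤ 3 * K / 2 * (h / ε) ^ 2 := by
  have := interp_bound (hS.hU.mono ha0 hb1) (C2On.sq.cmul (3 * K / ε ^ 2))
    (fun t ht => (hS.bu2 hε t ⟨by linarith [ht.1], by linarith [ht.2]⟩).trans
      (rhs_fine hc₀ hK hε hε1 ⟨by linarith [ht.1], by linarith [ht.2]⟩)) (by linarith) ht
  refine this.trans ?_
  subst hb
  have e1 : 3 * K / ε ^ 2 * (a ^ 2 / 2) + (3 * K / ε ^ 2 * ((a + h) ^ 2 / 2)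
      - 3 * K / ε ^ 2 * (a ^ 2 / 2)) * (t - a) / (a + h - a) - 3 * K / ε ^ 2 * (t ^ 2 / 2)
      = 3 * K / 2 / ε ^ 2 * ((t - a) * (a + h - t)) := by
    rw [show a + h - a = h by ring]
    field_simp; ring
  have e2 : 3 * K / 2 * (h / ε) ^ 2 = 3 * K / 2 / ε ^ 2 * h ^ 2 := by ring
  rw [e1, e2]
  gcongr
  nlinarith [ht.1, ht.2]

lemma interp_coarse (hS : SolB c₀ K ε u u1 p p1 p2) (hc₀ : 0 < c₀) (hK : 0 < K) (hε : 0 < ε)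
    {a b t h e : ℝ} (hh : 0 < h) (hb : b = a + h) (ha0 : 0 ≤ a) (hb1 : b ≤ 1)
    (he : ∀ t ∈ Icc a b, Elay (c₀ / ε) t ≤ e) (ht : t ∈ Icc a b) :
    |u a + (u b - u a) * (t - a) / (b - a) - u t| ≤ K * (h ^ 2 + (c₀ ^ 2)⁻¹ * e) := by
  have := interp_bound (hS.hU.mono ha0 hb1) (C2On_Qc a b hc₀ hε)
    (fun t ht => hS.bu2 hε t ⟨by linarith [ht.1], by linarith [ht.2]⟩) (by linarith) ht
  refine this.trans ?_
  have ea := he a ⟨le_rfl, by linarith⟩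
  have eb := he b ⟨by linarith, le_rfl⟩
  have et := Elay_pos (c₀ / ε) t
  subst hb
  set s := (t - a) / h with hs
  have hs0 : 0 ≤ s := div_nonneg (by linarith [ht.1]) hh.le
  have hs1 : s ≤ 1 := by rw [hs, div_le_one hh]; linarith [ht.2]
  have hta : t = a + s * h := by rw [hs]; field_simp; ring
  have e1 : ∀ P Q : ℝ, P + Q * (t - a) / (a + h - a) = P + Q * s := fun P Q => by
    rw [show a + h - a = h by ring, hs]; ring
  rw [e1]
  have hci : 0 < (c₀ ^ 2)⁻¹ := by positivity
  have key : a ^ 2 / 2 * (1 - s) + (a + h) ^ 2 / 2 * s - t ^ 2 / 2 + (c₀ ^ 2)⁻¹ *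
      ((1 - s) * Elay (c₀ / ε) a + s * Elay (c₀ / ε) (a + h) - Elay (c₀ / ε) t)
      ≤ h ^ 2 + (c₀ ^ 2)⁻¹ * e := by
    have g1 : a ^ 2 / 2 * (1 - s) + (a + h) ^ 2 / 2 * s - t ^ 2 / 2
        = h ^ 2 * (s * (1 - s) / 2) := by rw [hta]; ring
    have g2 : h ^ 2 * (s * (1 - s) / 2) ≤ h ^ 2 * 1 := by
      gcongr; nlinarith
    have g3 : (1 - s) * Elay (c₀ / ε) a + s * Elay (c₀ / ε) (a + h) - Elay (c₀ / ε) t ≤ e := by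
      have := mul_le_mul_of_nonneg_left ea (show 0 ≤ 1 - s by linarith)
      have := mul_le_mul_of_nonneg_left eb hs0
      linarith
    have g4 := mul_le_mul_of_nonneg_left g3 hci.le
    linarith
  have := mul_le_mul_of_nonneg_left key hK.le
  linarith

end est

lemma discrete_comp {x e B : ℕ → ℝ} {N : ℕ} (hx : ∀ i < N, x i < x (i + 1)) (h0 : e 0 ≤ B 0)
    (hN : e N ≤ B N)
    (h : ∀ i, 1 ≤ i → i < N → B i < e i → ddiff x B i < ddiff x e i) :
    ∀ i ≤ N, e i ≤ B i := by
  obtain ⟨j, hj, hmax⟩ := Finset.exists_max_image (Finset.range (N + 1)) (fun i => e i - B i)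
    ⟨0, by simp⟩
  have hmax' : ∀ i ≤ N, e i - B i ≤ e j - B j := fun i hi => hmax i (by simp; omega)
  have hjN : j ≤ N := by simp at hj; omega
  by_contra! hc
  obtain ⟨i, hi, hlt⟩ := hc
  have hpos : 0 < e j - B j := by linarith [hmax' i hi]
  have hj0 : j ≠ 0 := by rintro rfl; linarith
  have hjn : j ≠ N := by rintro rfl; linarith
  have hlt' : j < N := by omega
  have key := h j (by omega) hlt' (by linarith)
  have x1 := hx j hlt'
  have x2 := hx (j - 1) (by omega)
  rw [show j - 1 + 1 = j by omega] at x2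
  have m1 := hmax' (j + 1) (by omega)
  have m2 := hmax' (j - 1) (by omega)
  unfold ddiff at key
  have hp : 0 < 2 / (x (j + 1) - x (j - 1)) := div_pos (by norm_num) (by linarith)
  have key2 := lt_of_mul_lt_mul_left key hp.le
  have d1 : 0 < x (j + 1) - x j := by linarith
  have d2 : 0 < x j - x (j - 1) := by linarith
  have g1 : (e (j + 1) - e j) / (x (j + 1) - x j) ≤ (B (j + 1) - B j) / (x (j + 1) - x j) := by
    gcongr ?_ / _; linarith
  have g2 : (B j - B (j - 1)) / (x j - x (j - 1)) ≤ (e j - e (j - 1)) / (x j - x (j - 1)) := by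
    gcongr ?_ / _; linarith
  linarith

/-- the transition parameter -/
def alph (γ ε : ℝ) (n : ℕ) : ℝ := min (1/4) (2 * γ⁻¹ * ε * Real.log n)

lemma lam_eq (γ ε : ℝ) (n : ℕ) (t : ℝ) : shishkinLam γ ε n t =
    if t ≤ 1/4 then 4 * alph γ ε n * t
    else if t ≤ 1/2 then alph γ ε n + 2*(1-2*alph γ ε n)*(t-1/4)
    else 1 - (if 1-t ≤ 1/4 then 4*alph γ ε n*(1-t)
      else alph γ ε n + 2*(1-2*alph γ ε n)*((1-t)-1/4)) := rfl

lemma mesh_left {γ ε : ℝ} {m i : ℕ} (hm : 0 < m) (hi : i ≤ m) :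
    shishkinMesh γ ε (4 * m) i = alph γ ε (4 * m) * i / m := by
  have hmR : (0:ℝ) < m := by exact_mod_cast hm
  have hiR : (i:ℝ) ≤ m := by exact_mod_cast hi
  have h : (i:ℝ) / ((4 * m : ℕ) : ℝ) ≤ 1 / 4 := by
    push_cast; rw [div_le_iff₀ (by positivity)]; linarith
  rw [shishkinMesh, lam_eq, if_pos h]
  push_cast
  field_simp

lemma mesh_mid {γ ε : ℝ} {m i : ℕ} (hm : 0 < m) (hi : m ≤ i) (hi3 : i ≤ 3 * m) :
    shishkinMesh γ ε (4 * m) i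
      = alph γ ε (4 * m) + (1 - 2 * alph γ ε (4 * m)) * ((i:ℝ) - m) / (2 * m) := by
  have hmR : (0:ℝ) < m := by exact_mod_cast hm
  have hiR : (m:ℝ) ≤ i := by exact_mod_cast hi
  have hiR3 : (i:ℝ) ≤ 3 * m := by exact_mod_cast hi3
  rw [shishkinMesh, lam_eq]
  have e : ((4 * m : ℕ) : ℝ) = 4 * (m:ℝ) := by push_cast; ring
  rw [e]
  split_ifs with h1 h2 h3
  · rw [div_le_iff₀ (by positivity)] at h1
    have : (i:ℝ) = m := by linarith
    rw [this]; field_simp; ring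
  · field_simp; ring
  · have h4 : (3/4 : ℝ) ≤ (i:ℝ) / (4 * m) := by linarith
    rw [le_div_iff₀ (by positivity)] at h4
    have : (i:ℝ) = 3 * m := by linarith
    rw [this]; field_simp; ring
  · field_simp; ring

lemma mesh_right {γ ε : ℝ} {m i : ℕ} (hm : 0 < m) (hi : 3 * m ≤ i) (hi4 : i ≤ 4 * m) :
    shishkinMesh γ ε (4 * m) i = 1 - alph γ ε (4 * m) * (4 * m - (i:ℝ)) / m := by
  have hmR : (0:ℝ) < m := by exact_mod_cast hm
  have hiR3 : 3 * (m:ℝ) ≤ i := by exact_mod_cast hi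
  rw [shishkinMesh, lam_eq]
  have e : ((4 * m : ℕ) : ℝ) = 4 * (m:ℝ) := by push_cast; ring
  rw [e]
  have h0 : (3/4:ℝ) ≤ (i:ℝ) / (4 * m) := by
    rw [le_div_iff₀ (by positivity)]; linarith
  rw [if_neg (by linarith), if_neg (by linarith), if_pos (by linarith)]
  field_simp

/-- facts about the Shishkin mesh -/
structure MeshS (x : ℕ → ℝ) (m : ℕ) (α hf hc : ℝ) : Prop where
  x0 : x 0 = 0
  xm : x m = α
  x3 : x (3 * m) = 1 - α
  xN : x (4 * m) = 1
  left : ∀ i < m, x (i + 1) = x i + hf ∧ 0 ≤ x i ∧ x (i + 1) ≤ α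
  mid : ∀ i, m ≤ i → i < 3 * m → x (i + 1) = x i + hc ∧ α ≤ x i ∧ x (i + 1) ≤ 1 - α
  right : ∀ i, 3 * m ≤ i → i < 4 * m → x (i + 1) = x i + hf ∧ 1 - α ≤ x i ∧ x (i + 1) ≤ 1

lemma mesh_spec {γ ε : ℝ} {m : ℕ} (hm : 0 < m) (hα : 0 < alph γ ε (4 * m)) :
    MeshS (shishkinMesh γ ε (4 * m)) m (alph γ ε (4 * m)) (alph γ ε (4 * m) / m)
      ((1 - 2 * alph γ ε (4 * m)) / (2 * m)) := by
  have hmR : (0:ℝ) < m := by exact_mod_cast hm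
  have hα4 : alph γ ε (4 * m) ≤ 1 / 4 := min_le_left _ _
  set α := alph γ ε (4 * m) with hαd
  refine ⟨?_, ?_, ?_, ?_, fun i hi => ?_, fun i hi hi3 => ?_, fun i hi hi4 => ?_⟩
  · rw [mesh_left hm (by omega)]; simp
  · rw [mesh_left hm le_rfl]; field_simp; rfl
  · rw [mesh_right hm le_rfl (by omega), ← hαd]; push_cast; field_simp; ring
  · rw [mesh_right hm (by omega) le_rfl, ← hαd]; push_cast; simp
  · rw [mesh_left hm (by omega), mesh_left hm (by omega), ← hαd]
    have : (i:ℝ) + 1 ≤ m := by exact_mod_cast hi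
    push_cast
    refine ⟨by field_simp, by positivity, ?_⟩
    rw [div_le_iff₀ hmR]
    gcongr
  · rw [mesh_mid hm (by omega) (by omega), mesh_mid hm (by omega) (by omega), ← hαd]
    have h1 : (i:ℝ) + 1 ≤ 3 * m := by exact_mod_cast hi3
    have h2 : (m:ℝ) ≤ i := by exact_mod_cast hi
    push_cast
    refine ⟨by field_simp; ring, ?_, ?_⟩
    · have : 0 ≤ (1 - 2 * α) * ((i:ℝ) - m) / (2 * m) :=
        div_nonneg (mul_nonneg (by linarith) (by linarith)) (by positivity)
      linarith
    · have : (1 - 2 * α) * ((i:ℝ) + 1 - m) / (2 * m) ≤ 1 - 2 * α := by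
        rw [div_le_iff₀ (by positivity)]
        apply mul_le_mul_of_nonneg_left _ (by linarith)
        linarith
      linarith
  · rw [mesh_right hm (by omega) (by omega), mesh_right hm (by omega) (by omega), ← hαd]
    have h1 : (i:ℝ) + 1 ≤ 4 * m := by exact_mod_cast hi4
    have h2 : 3 * (m:ℝ) ≤ i := by exact_mod_cast hi
    push_cast
    refine ⟨by field_simp; ring, ?_, ?_⟩
    · have : α * (4 * m - (i:ℝ)) / m ≤ α := by
        rw [div_le_iff₀ hmR]
        apply mul_le_mul_of_nonneg_left _ hα.le
        linarith
      linarith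
    · have : 0 ≤ α * (4 * m - ((i:ℝ) + 1)) / m :=
        div_nonneg (mul_nonneg hα.le (by linarith)) hmR.le
      linarith

/-- hat barrier -/
def psi (x : ℕ → ℝ) (m : ℕ) (α : ℝ) (i : ℕ) : ℝ :=
  if i ≤ m then x i else if i ≤ 3 * m then α else 1 - x i

section psi
variable {x : ℕ → ℝ} {m : ℕ} {α hf hc : ℝ}

lemma psi_left {i : ℕ} (hi : i ≤ m) : psi x m α i = x i := if_pos hi

lemma psi_mid (hM : MeshS x m α hf hc) {i : ℕ} (hi : m ≤ i) (hi3 : i ≤ 3 * m) :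
    psi x m α i = α := by
  unfold psi
  split_ifs with h
  · rw [show i = m by omega, hM.xm]
  · rfl

lemma psi_right (hM : MeshS x m α hf hc) (hm : 0 < m) {i : ℕ} (hi : 3 * m ≤ i) :
    psi x m α i = 1 - x i := by
  rcases eq_or_lt_of_le hi with h | h
  · rw [psi_mid hM (by omega) (by omega), ← h, hM.x3]; ring
  · unfold psi
    rw [if_neg (by omega), if_neg (by omega)]

lemma psi_bounds (hM : MeshS x m α hf hc) (hm : 0 < m) (hα : 0 < α) {i : ℕ} (hi : i ≤ 4 * m) :
    0 ≤ psi x m α i ∧ psi x m α i ≤ α := by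
  rcases le_total i m with h1 | h1
  · rw [psi_left h1]
    rcases eq_or_lt_of_le h1 with h | h
    · rw [h, hM.xm]; exact ⟨hα.le, le_rfl⟩
    · obtain ⟨a, b, c⟩ := hM.left i h
      refine ⟨b, ?_⟩
      cases i with
      | zero => rw [hM.x0]; exact hα.le
      | succ j => exact (hM.left j (by omega)).2.2
  · rcases le_total i (3 * m) with h2 | h2
    · rw [psi_mid hM h1 h2]; exact ⟨hα.le, le_rfl⟩
    · rw [psi_right hM hm h2]
      obtain ⟨a, b, c⟩ := hM.right (i - 1 + (if i = 3 * m then 1 else 0))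
        (by split_ifs <;> omega) (by split_ifs <;> omega)
      split_ifs at a b c with h
      · rw [h, hM.x3]; exact ⟨by linarith, by linarith⟩
      · simp only [add_zero] at a b c
        rw [show i - 1 + 1 = i by omega] at a c
        refine ⟨by linarith, ?_⟩
        rcases eq_or_lt_of_le hi with h' | h'
        · rw [h', hM.xN]; linarith
        · linarith [(hM.right i h2 h').2.1]

lemma step_pos (hM : MeshS x m α hf hc) (hhf : 0 < hf) (hhc : 0 < hc) :
    ∀ i < 4 * m, x i < x (i + 1) := by
  intro i hi
  by_cases h1 : i < m
  · linarith [(hM.left i h1).1]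
  · by_cases h2 : i < 3 * m
    · linarith [(hM.mid i (by omega) h2).1]
    · linarith [(hM.right i (by omega) hi).1]

lemma psi_ddiff (hM : MeshS x m α hf hc) (hm : 0 < m) (hhf : 0 < hf) (hhc : 0 < hc)
    {i : ℕ} (hi1 : 1 ≤ i) (hi : i < 4 * m) :
    ddiff x (psi x m α) i ≤ 0 ∧
      (i = m ∨ i = 3 * m → ddiff x (psi x m α) i = - (2 / (hf + hc))) := by
  obtain ⟨j, rfl⟩ : ∃ j, i = j + 1 := ⟨i - 1, by omega⟩
  unfold ddiff
  rw [show j + 1 - 1 = j by omega]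
  rcases lt_trichotomy (j + 1) m with h | h | h
  · have a := (hM.left j (by omega)).1
    have b := (hM.left (j + 1) h).1
    rw [psi_left (by omega), psi_left (by omega), psi_left (by omega), b, a]
    refine ⟨le_of_eq ?_, fun h' => by omega⟩
    rw [show x j + hf + hf - (x j + hf) = hf by ring, show x j + hf - x j = hf by ring]; simp
  · have a := (hM.left j (by omega)).1
    have b := (hM.mid (j + 1) (by omega) (by omega)).1
    have e : 2 / (x (j + 1 + 1) - x j) * ((psi x m α (j + 1 + 1) - psi x m α (j + 1)) /
        (x (j + 1 + 1) - x (j + 1)) - (psi x m α (j + 1) - psi x m α j) / (x (j + 1) - x j))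
        = - (2 / (hf + hc)) := by
      rw [psi_mid hM (i := j + 1 + 1) (by omega) (by omega),
        psi_mid hM (i := j + 1) (by omega) (by omega),
        psi_left (i := j) (by omega), b, a]
      have : α = x j + hf := by rw [← a, h, hM.xm]
      rw [this, show x j + hf - x j = hf by ring,
        show x j + hf + hc - x j = hf + hc by ring, div_self hhf.ne']
      simp
    rw [e]
    exact ⟨by have : 0 < 2 / (hf + hc) := by positivity
              linarith, fun _ => rfl⟩
  · rcases lt_trichotomy (j + 1) (3 * m) with h3 | h3 | h3
    · rw [psi_mid hM (i := j + 1 + 1) (by omega) (by omega),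
        psi_mid hM (i := j + 1) (by omega) (by omega),
        psi_mid hM (i := j) (by omega) (by omega)]
      exact ⟨by simp, fun h' => by omega⟩
    · have a := (hM.mid j (by omega) (by omega)).1
      have b := (hM.right (j + 1) (by omega) (by omega)).1
      have e : 2 / (x (j + 1 + 1) - x j) * ((psi x m α (j + 1 + 1) - psi x m α (j + 1)) /
          (x (j + 1 + 1) - x (j + 1)) - (psi x m α (j + 1) - psi x m α j) / (x (j + 1) - x j))
          = - (2 / (hf + hc)) := by
        have h5 : α = 1 - (x j + hc) := by rw [← a, h3, hM.x3]; ring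
        rw [psi_right hM hm (i := j + 1 + 1) (by omega),
          psi_mid hM (i := j + 1) (by omega) (by omega),
          psi_mid hM (i := j) (by omega) (by omega), b, a, h5,
          show 1 - (x j + hc + hf) - (1 - (x j + hc)) = - hf by ring,
          show x j + hc + hf - (x j + hc) = hf by ring,
          show x j + hc + hf - x j = hf + hc by ring, neg_div, div_self hhf.ne']
        simp
      rw [e]
      exact ⟨by have : 0 < 2 / (hf + hc) := by positivity
                linarith, fun _ => rfl⟩
    · have a := (hM.right j (by omega) (by omega)).1
      have b := (hM.right (j + 1) (by omega) (by omega)).1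
      rw [psi_right hM hm (i := j + 1 + 1) (by omega),
          psi_right hM hm (i := j + 1) (by omega),
          psi_right hM hm (i := j) (by omega), b, a]
      refine ⟨le_of_eq ?_, fun h' => by omega⟩
      rw [show 1 - (x j + hf + hf) - (1 - (x j + hf)) = - hf by ring,
        show 1 - (x j + hf) - (1 - x j) = - hf by ring,
        show x j + hf + hf - (x j + hf) = hf by ring, show x j + hf - x j = hf by ring]
      simp

end psi

/-- quantitative facts about the mesh parameters -/
structure Setup (c₀ K ε n L κ Cp α hf hc : ℝ) : Prop where
  hc₀ : 0 < c₀
  hK : 0 < K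
  hε : 0 < ε
  hε1 : ε ≤ 1
  hn : 0 < n
  hL : 1 ≤ L
  hκ : 0 < κ
  hC : 0 < Cp
  hα : 0 < α
  hα4 : α ≤ 1 / 4
  hαL : α ≤ κ * ε * L
  hf0 : 0 < hf
  hfκ : hf / ε ≤ κ * (L / n)
  hfα : hf ≤ α
  hfc : hf ≤ hc
  hc2 : hc ≤ 2 / n
  dich : hf = hc ∨ ∀ t ∈ Icc (α - hf) (1 - α + hf), Elay (c₀ / ε) t ≤ Cp / n ^ 2

/-- constant of the truncation error -/
def TrC (c₀ K κ Cp : ℝ) : ℝ :=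
  3 * K / 2 * κ ^ 2 + K * (2 + (c₀ ^ 2)⁻¹ * Cp) + 2 * K * (1 + Cp) + 34 * K * (1 + Cp)

section asm
variable {c₀ K ε n L κ Cp α hf hc : ℝ} {u u1 p p1 p2 : ℝ → ℝ} {x : ℕ → ℝ} {m : ℕ}

lemma Setup.fine (S : Setup c₀ K ε n L κ Cp α hf hc) :
    3 * K / 2 * (hf / ε) ^ 2 ≤ 3 * K / 2 * κ ^ 2 * (L ^ 2 / n ^ 2) := by
  have h0 : 0 ≤ hf / ε := (div_pos S.hf0 S.hε).le
  have hK := S.hK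
  calc 3 * K / 2 * (hf / ε) ^ 2 ≤ 3 * K / 2 * (κ * (L / n)) ^ 2 := by
        gcongr; exact S.hfκ
    _ = _ := by ring

lemma Setup.inv (S : Setup c₀ K ε n L κ Cp α hf hc) : 1 / n ^ 2 ≤ L ^ 2 / n ^ 2 := by
  have := S.hL
  have := S.hn
  gcongr
  nlinarith

lemma Setup.hcsq (S : Setup c₀ K ε n L κ Cp α hf hc) : hc ^ 2 ≤ 4 * (1 / n ^ 2) := by
  have h1 : 0 ≤ hc := S.hf0.le.trans S.hfc
  calc hc ^ 2 ≤ (2 / n) ^ 2 := by gcongr; exact S.hc2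
    _ = _ := by ring

lemma trunc_all (S : Setup c₀ K ε n L κ Cp α hf hc) (hS : SolB c₀ K ε u u1 p p1 p2)
    (hM : MeshS x m α hf hc) (hm : 0 < m) {i : ℕ} (h1 : 1 ≤ i) (hi : i < 4 * m) :
    |ε ^ 2 * ddiff x (fun j => u (x j)) i - p (x i)| ≤ TrC c₀ K κ Cp * (L ^ 2 / n ^ 2) ∨
    ((i = m ∨ i = 3 * m) ∧
      |ε ^ 2 * ddiff x (fun j => u (x j)) i - p (x i)| ≤ TrC c₀ K κ Cp * (ε / n)) := by
  obtain ⟨j, rfl⟩ : ∃ j, i = j + 1 := ⟨i - 1, by omega⟩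
  have hK := S.hK
  have hC := S.hC
  have hc₀ := S.hc₀
  have hn := S.hn
  have hε := S.hε
  have hκ := S.hκ
  have hhc : 0 < hc := S.hf0.trans_le S.hfc
  have hinv := S.inv
  have hq : 0 < 1 / n ^ 2 := by positivity
  have hfm : ∀ {v : ℝ}, v ≤ 3 * K / 2 * (hf / ε) ^ 2 → v ≤ TrC c₀ K κ Cp * (L ^ 2 / n ^ 2) := by
    intro v hv
    refine hv.trans (S.fine.trans ?_)
    unfold TrC
    gcongr
    have : 0 < K * (2 + (c₀ ^ 2)⁻¹ * Cp) + 2 * K * (1 + Cp) + 34 * K * (1 + Cp) := by positivity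
    linarith
  have hxpos : ∀ k ≤ 4 * m, 0 ≤ x k ∧ x k ≤ 1 := by
    intro k hk
    have hα := S.hα
    have hα4 := S.hα4
    rcases Nat.eq_zero_or_pos k with h0 | h0
    · rw [h0, hM.x0]; exact ⟨le_rfl, zero_le_one⟩
    · obtain ⟨l, rfl⟩ : ∃ l, k = l + 1 := ⟨k - 1, by omega⟩
      have hf0 := S.hf0
      rcases lt_or_ge l m with a1 | a1
      · obtain ⟨a, b, c⟩ := hM.left l a1; exact ⟨by linarith, by linarith⟩
      · rcases lt_or_ge l (3 * m) with a2 | a2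
        · obtain ⟨a, b, c⟩ := hM.mid l a1 a2; exact ⟨by linarith, by linarith⟩
        · obtain ⟨a, b, c⟩ := hM.right l a2 (by omega); exact ⟨by linarith, by linarith⟩
  simp only [ddiff, Nat.add_sub_cancel]
  have ha0 := (hxpos j (by omega)).1
  have hc1 := (hxpos (j + 1 + 1) (by omega)).2
  have fine : x (j + 1) = x j + hf → x (j + 1 + 1) = x (j + 1) + hf → _ := fun e1 e2 =>
    hfm (trunc_fine hS hc₀ hK hε S.hε1 S.hf0 (by linarith) e2 ha0 hc1)
  rcases S.dich with hd | hd
  · -- uniform mesh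
    have hstep : ∀ k < 4 * m, x (k + 1) = x k + hf := by
      intro k hk
      rcases lt_or_ge k m with a1 | a1
      · exact (hM.left k a1).1
      · rcases lt_or_ge k (3 * m) with a2 | a2
        · rw [hd]; exact (hM.mid k a1 a2).1
        · exact (hM.right k a2 hk).1
    exact Or.inl (fine (hstep j (by omega)) (hstep (j + 1) hi))
  · -- transition nodes
    have trans : x j < x (j + 1) → x (j + 1) < x (j + 1 + 1) → α - hf ≤ x j →
        x (j + 1 + 1) ≤ 1 - α + hf → x (j + 1) - x j ≤ hc → x (j + 1 + 1) - x (j + 1) ≤ hc →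
        (j + 1 = m ∨ j + 1 = 3 * m) →
        (|ε ^ 2 * (2 / (x (j + 1 + 1) - x j) *
          ((u (x (j + 1 + 1)) - u (x (j + 1))) / (x (j + 1 + 1) - x (j + 1)) -
            (u (x (j + 1)) - u (x j)) / (x (j + 1) - x j))) - p (x (j + 1))|
          ≤ TrC c₀ K κ Cp * (L ^ 2 / n ^ 2) ∨ ((j + 1 = m ∨ j + 1 = 3 * m) ∧
        |ε ^ 2 * (2 / (x (j + 1 + 1) - x j) *
          ((u (x (j + 1 + 1)) - u (x (j + 1))) / (x (j + 1 + 1) - x (j + 1)) -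
            (u (x (j + 1)) - u (x j)) / (x (j + 1) - x j))) - p (x (j + 1))|
          ≤ TrC c₀ K κ Cp * (ε / n))) := by
      intro b1 b2 b3 b4 b5 b6 b7
      rcases le_total ε (1 / n) with hε' | hε'
      · refine Or.inl ((trunc_trans1 hS hK hε b1 b2 ha0 hc1 (e := Cp / n ^ 2)
          (fun t ht => hd t ⟨b3.trans ht.1, ht.2.trans b4⟩)).trans ?_)
        have : ε ^ 2 ≤ 1 / n ^ 2 := by
          calc ε ^ 2 ≤ (1 / n) ^ 2 := by gcongr
            _ = _ := by ring
        calc 2 * (K * (ε ^ 2 + Cp / n ^ 2)) ≤ 2 * (K * (1 / n ^ 2 + Cp / n ^ 2)) := by gcongr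
          _ = 2 * K * (1 + Cp) * (1 / n ^ 2) := by ring
          _ ≤ 2 * K * (1 + Cp) * (L ^ 2 / n ^ 2) := by gcongr
          _ ≤ _ := by
            unfold TrC
            have hq' : 0 < L ^ 2 / n ^ 2 := hq.trans_le hinv
            gcongr
            have : 0 < 3 * K / 2 * κ ^ 2 + K * (2 + (c₀ ^ 2)⁻¹ * Cp) + 34 * K * (1 + Cp) := by
              positivity
            linarith
      · refine Or.inr ⟨b7, (trunc_trans2 hS hK hε S.hε1 (e := Cp / n ^ 2) (C := Cp) (r := 2 / n)
          (by linarith [S.hfα]) (by linarith [S.hfα]) (by linarith [S.hα4, S.hf0]) b3 b4 b1 b2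
          (b5.trans S.hc2) (b6.trans S.hc2) hd ?_).trans ?_⟩
        · calc Cp / n ^ 2 = Cp * (1 / n) ^ 2 := by ring
            _ ≤ _ := by gcongr
        · calc 17 * K * (1 + Cp) * ε * (2 / n) = 34 * K * (1 + Cp) * (ε / n) := by ring
            _ ≤ _ := by
              unfold TrC
              gcongr
              have : 0 < 3 * K / 2 * κ ^ 2 + K * (2 + (c₀ ^ 2)⁻¹ * Cp) + 2 * K * (1 + Cp) := by
                positivity
              linarith
    have hf0 := S.hf0
    have hfc := S.hfc
    rcases lt_trichotomy (j + 1) m with a1 | a1 | a1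
    · exact Or.inl (fine (hM.left j (by omega)).1 (hM.left (j + 1) (by omega)).1)
    · have e1 := hM.left j (by omega)
      have e2 := hM.mid (j + 1) (by omega) (by omega)
      have e3 := hM.xm
      rw [← a1] at e3
      exact trans (by linarith) (by linarith) (by linarith) (by linarith) (by linarith)
        (by linarith) (Or.inl a1)
    · rcases lt_trichotomy (j + 1) (3 * m) with a2 | a2 | a2
      · left
        have e1 := hM.mid j (by omega) (by omega)
        have e2 := hM.mid (j + 1) (by omega) (by omega)
        refine (trunc_coarse hS hc₀ hK hε hhc (by linarith) e2.1 ha0 hc1 (e := Cp / n ^ 2)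
          (fun t ht => hd t ⟨by linarith [ht.1], by linarith [ht.2]⟩)).trans ?_
        have := S.hcsq
        calc K / 2 * (hc ^ 2 + 2 * (c₀ ^ 2)⁻¹ * (Cp / n ^ 2))
            ≤ K / 2 * (4 * (1 / n ^ 2) + 2 * (c₀ ^ 2)⁻¹ * (Cp / n ^ 2)) := by gcongr
          _ = K * (2 + (c₀ ^ 2)⁻¹ * Cp) * (1 / n ^ 2) := by ring
          _ ≤ K * (2 + (c₀ ^ 2)⁻¹ * Cp) * (L ^ 2 / n ^ 2) := by gcongr
          _ ≤ _ := by
            unfold TrC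
            have hq' : 0 < L ^ 2 / n ^ 2 := hq.trans_le hinv
            gcongr
            have : 0 < 3 * K / 2 * κ ^ 2 + 2 * K * (1 + Cp) + 34 * K * (1 + Cp) := by
              positivity
            linarith
      · have e1 := hM.mid j (by omega) (by omega)
        have e2 := hM.right (j + 1) (by omega) (by omega)
        have e3 := hM.x3
        rw [← a2] at e3
        exact trans (by linarith) (by linarith) (by linarith) (by linarith) (by linarith)
          (by linarith) (Or.inr a2)
      · exact Or.inl (fine (hM.right j (by omega) (by omega)).1 (hM.right (j + 1) (by omega) hi).1)

end asm

section asm2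
variable {c₀ K ε n L κ Cp α hf hc : ℝ} {u u1 p p1 p2 : ℝ → ℝ} {x : ℕ → ℝ} {m : ℕ}

lemma mesh_range (S : Setup c₀ K ε n L κ Cp α hf hc) (hM : MeshS x m α hf hc) {k : ℕ}
    (hk : k ≤ 4 * m) : x k ∈ Icc (0:ℝ) 1 := by
  have hα := S.hα
  have hα4 := S.hα4
  rcases Nat.eq_zero_or_pos k with h0 | h0
  · rw [h0, hM.x0]; exact ⟨le_rfl, zero_le_one⟩
  · obtain ⟨l, rfl⟩ : ∃ l, k = l + 1 := ⟨k - 1, by omega⟩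
    have hf0 := S.hf0
    have hfc := S.hfc
    rcases lt_or_ge l m with a1 | a1
    · obtain ⟨a, b, c⟩ := hM.left l a1; exact ⟨by linarith, by linarith⟩
    · rcases lt_or_ge l (3 * m) with a2 | a2
      · obtain ⟨a, b, c⟩ := hM.mid l a1 a2; exact ⟨by linarith, by linarith⟩
      · obtain ⟨a, b, c⟩ := hM.right l a2 (by omega); exact ⟨by linarith, by linarith⟩

lemma ddiff_sub (x y z : ℕ → ℝ) (i : ℕ) :
    ddiff x (fun j => y j - z j) i = ddiff x y i - ddiff x z i := by
  unfold ddiff; ring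

lemma ddiff_affine (x z : ℕ → ℝ) (a s : ℝ) (i : ℕ) :
    ddiff x (fun j => a + s * z j) i = s * ddiff x z i := by
  unfold ddiff; ring

/-- constant of the nodal error -/
def NdC (c₀ K κ Cp : ℝ) : ℝ := TrC c₀ K κ Cp / c₀ ^ 2 + 2 * TrC c₀ K κ Cp * κ

lemma TrC_pos (S : Setup c₀ K ε n L κ Cp α hf hc) : 0 < TrC c₀ K κ Cp := by
  have hK := S.hK
  have hC := S.hC
  have hc₀ := S.hc₀
  have hκ := S.hκ
  unfold TrC
  positivity

lemma nodal {f : ℝ → ℝ → ℝ} (S : Setup c₀ K ε n L κ Cp α hf hc)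
    (hS : SolB c₀ K ε u u1 (fun x => f x (u x)) p1 p2)
    (hM : MeshS x m α hf hc) (hm : 0 < m)
    (hmono : ∀ x ∈ Icc (0:ℝ) 1, ∀ a b, a ≤ b → c₀ ^ 2 * (b - a) ≤ f x b - f x a)
    (hu0 : u 0 = 0) (hu1 : u 1 = 0) {y : ℕ → ℝ} (hy : NonlinScheme f ε x (4 * m) y) {i : ℕ}
    (hi : i ≤ 4 * m) : |y i - u (x i)| ≤ NdC c₀ K κ Cp * (L ^ 2 / n ^ 2) := by
  have hT := TrC_pos S
  set T := TrC c₀ K κ Cp with hTd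
  have hc₀ := S.hc₀
  have hn := S.hn
  have hε := S.hε
  have hκ := S.hκ
  have hL := S.hL
  have hhc : 0 < hc := S.hf0.trans_le S.hfc
  have hq : 0 < L ^ 2 / n ^ 2 := by positivity
  set s : ℝ := 2 * T / (ε * n ^ 2) with hs
  have hs0 : 0 < s := by positivity
  set B : ℕ → ℝ := fun i => T / c₀ ^ 2 * (L ^ 2 / n ^ 2) + s * psi x m α i with hB
  have hstep := step_pos hM S.hf0 hhc
  have hBpos : ∀ i ≤ 4 * m, 0 ≤ B i := fun i hi => by
    have := (psi_bounds hM hm S.hα hi).1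
    simp only [hB]; positivity
  have hc2 : 0 < c₀ ^ 2 := by positivity
  have hε2 : 0 < ε ^ 2 := by positivity
  have key : ∀ i, 1 ≤ i → i < 4 * m →
      |ε ^ 2 * ddiff x (fun j => u (x j)) i - f (x i) (u (x i))|
        ≤ c₀ ^ 2 * B i - ε ^ 2 * ddiff x B i := by
    intro i h1 hi
    have hp := psi_bounds hM hm S.hα hi.le
    obtain ⟨d1, d2⟩ := psi_ddiff hM hm S.hf0 hhc h1 hi
    have eB : ddiff x B i = s * ddiff x (psi x m α) i := ddiff_affine x _ _ _ i
    have eB2 : c₀ ^ 2 * B i = T * (L ^ 2 / n ^ 2) + c₀ ^ 2 * (s * psi x m α i) := by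
      simp only [hB]; field_simp
    have e3 : 0 ≤ c₀ ^ 2 * (s * psi x m α i) := by
      have := hp.1
      positivity
    rw [eB, eB2]
    rcases trunc_all S hS hM hm h1 hi with h | ⟨hmm, h⟩
    · refine h.trans ?_
      have : 0 ≤ ε ^ 2 * (s * -ddiff x (psi x m α) i) := by
        have : 0 ≤ -ddiff x (psi x m α) i := by linarith
        positivity
      linarith
    · refine h.trans ?_
      rw [d2 hmm]
      have hsum : hf + hc ≤ 4 / n := by
        have := S.hc2
        have := S.hfc
        have e : 4 / n = 2 / n + 2 / n := by ring
        linarith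
      have hpos : 0 < hf + hc := add_pos S.hf0 hhc
      have : T * (ε / n) ≤ ε ^ 2 * (s * (2 / (hf + hc))) := by
        calc T * (ε / n) = ε ^ 2 * (s * (2 / (4 / n))) := by
              rw [hs]; field_simp; ring
          _ ≤ _ := by gcongr
      have : 0 < T * (L ^ 2 / n ^ 2) := by positivity
      linarith
  obtain ⟨hy1, hy0, hyN⟩ := hy
  have up : ∀ i ≤ 4 * m, y i - u (x i) ≤ B i := by
    apply discrete_comp (e := fun i => y i - u (x i)) hstep
    · simp only [hy0, hM.x0, hu0]; simpa using hBpos 0 (by omega)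
    · simp only [hyN, hM.xN, hu1]; simpa using hBpos _ le_rfl
    · intro i h1 hi hlt
      have k := (abs_le.mp (key i h1 hi)).2
      have := hBpos i hi.le
      have hmo := hmono (x i) (mesh_range S hM hi.le) (u (x i)) (y i) (by linarith)
      have e1 := hy1 i h1 hi
      rw [ddiff_sub x y (fun j => u (x j)) i]
      have : c₀ ^ 2 * B i < c₀ ^ 2 * (y i - u (x i)) := by gcongr
      refine lt_of_mul_lt_mul_left ?_ hε2.le
      rw [mul_sub]
      linarith
  have dn : ∀ i ≤ 4 * m, u (x i) - y i ≤ B i := by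
    apply discrete_comp (e := fun i => u (x i) - y i) hstep
    · simp only [hy0, hM.x0, hu0]; simpa using hBpos 0 (by omega)
    · simp only [hyN, hM.xN, hu1]; simpa using hBpos _ le_rfl
    · intro i h1 hi hlt
      have k := (abs_le.mp (key i h1 hi)).1
      have := hBpos i hi.le
      have hmo := hmono (x i) (mesh_range S hM hi.le) (y i) (u (x i)) (by linarith)
      have e1 := hy1 i h1 hi
      rw [ddiff_sub x (fun j => u (x j)) y i]
      have : c₀ ^ 2 * B i < c₀ ^ 2 * (u (x i) - y i) := by gcongr
      refine lt_of_mul_lt_mul_left ?_ hε2.le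
      rw [mul_sub]
      linarith
  have hBle : B i ≤ NdC c₀ K κ Cp * (L ^ 2 / n ^ 2) := by
    have hp := (psi_bounds hM hm S.hα hi).2
    have h1 : s * psi x m α i ≤ 2 * T * κ * (L ^ 2 / n ^ 2) := by
      calc s * psi x m α i ≤ s * (κ * ε * L) := by gcongr; exact hp.trans S.hαL
        _ = 2 * T * κ * (L / n ^ 2) := by rw [hs]; field_simp
        _ ≤ _ := by gcongr; nlinarith
    simp only [hB, NdC, ← hTd]
    linarith
  have h1 := up i hi
  have h2 := dn i hi
  exact abs_le.mpr ⟨by linarith, by linarith⟩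

lemma find_cell {N : ℕ} {t : ℝ} (h0 : x 0 ≤ t) (hN : t ≤ x N) (hN0 : 0 < N) :
    ∃ i < N, t ∈ Icc (x i) (x (i + 1)) := by
  induction N with
  | zero => omega
  | succ k ih =>
    rcases le_total (x k) t with h | h
    · exact ⟨k, by omega, h, hN⟩
    · rcases Nat.eq_zero_or_pos k with hk | hk
      · subst hk; exact ⟨0, by omega, h0, hN⟩
      · obtain ⟨i, hi, ht⟩ := ih h hk
        exact ⟨i, by omega, ht⟩

/-- constant of the interpolation error -/
def InC (c₀ K κ Cp : ℝ) : ℝ := 3 * K / 2 * κ ^ 2 + K * (4 + (c₀ ^ 2)⁻¹ * Cp)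

lemma interp_all (S : Setup c₀ K ε n L κ Cp α hf hc) (hS : SolB c₀ K ε u u1 p p1 p2)
    (hM : MeshS x m α hf hc) {i : ℕ} (hi : i < 4 * m) {t : ℝ}
    (ht : t ∈ Icc (x i) (x (i + 1))) :
    |u (x i) + (u (x (i + 1)) - u (x i)) * (t - x i) / (x (i + 1) - x i) - u t|
      ≤ InC c₀ K κ Cp * (L ^ 2 / n ^ 2) := by
  have hK := S.hK
  have hC := S.hC
  have hc₀ := S.hc₀
  have hn := S.hn
  have hε := S.hε
  have hκ := S.hκ
  have hf0 := S.hf0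
  have hhc : 0 < hc := S.hf0.trans_le S.hfc
  have hinv := S.inv
  have hq : 0 < 1 / n ^ 2 := by positivity
  have hq' : 0 < L ^ 2 / n ^ 2 := hq.trans_le hinv
  have ha0 := (mesh_range S hM hi.le).1
  have hb1 := (mesh_range S hM (show i + 1 ≤ 4 * m by omega)).2
  have fine : x (i + 1) = x i + hf → 
      |u (x i) + (u (x (i + 1)) - u (x i)) * (t - x i) / (x (i + 1) - x i) - u t|
      ≤ InC c₀ K κ Cp * (L ^ 2 / n ^ 2) := by
    intro e
    refine (interp_fine hS hc₀ hK hε S.hε1 S.hf0 e ha0 hb1 ht).trans (S.fine.trans ?_)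
    unfold InC
    gcongr
    have : 0 < K * (4 + (c₀ ^ 2)⁻¹ * Cp) := by positivity
    linarith
  rcases lt_or_ge i m with a1 | a1
  · exact fine (hM.left i a1).1
  · rcases lt_or_ge i (3 * m) with a2 | a2
    · have e := hM.mid i a1 a2
      rcases S.dich with hd | hd
      · exact fine (by rw [hd]; exact e.1)
      · refine (interp_coarse hS hc₀ hK hε hhc e.1 ha0 hb1 (e := Cp / n ^ 2)
          (fun t ht => hd t ⟨by linarith [ht.1], by linarith [ht.2]⟩) ht).trans ?_
        have := S.hcsq
        calc K * (hc ^ 2 + (c₀ ^ 2)⁻¹ * (Cp / n ^ 2))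
            ≤ K * (4 * (1 / n ^ 2) + (c₀ ^ 2)⁻¹ * (Cp / n ^ 2)) := by gcongr
          _ = K * (4 + (c₀ ^ 2)⁻¹ * Cp) * (1 / n ^ 2) := by ring
          _ ≤ K * (4 + (c₀ ^ 2)⁻¹ * Cp) * (L ^ 2 / n ^ 2) := by gcongr
          _ ≤ _ := by
            unfold InC
            gcongr
            have : 0 < 3 * K / 2 * κ ^ 2 := by positivity
            linarith
    · exact fine (hM.right i a2 hi).1

lemma lin_err {a b t A B A' B' E : ℝ} (hab : a < b) (ht : t ∈ Icc a b) (h1 : |A - A'| ≤ E)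
    (h2 : |B - B'| ≤ E) :
    |(A + (B - A) * (t - a) / (b - a)) - (A' + (B' - A') * (t - a) / (b - a))| ≤ E := by
  have hba : 0 < b - a := by linarith
  set l := (t - a) / (b - a) with hl
  have l0 : 0 ≤ l := div_nonneg (by linarith [ht.1]) hba.le
  have l1 : l ≤ 1 := (div_le_one hba).mpr (by linarith [ht.2])
  have e : (A + (B - A) * (t - a) / (b - a)) - (A' + (B' - A') * (t - a) / (b - a))
      = (1 - l) * (A - A') + l * (B - B') := by
    rw [hl]; ring
  rw [e]
  rw [abs_le] at *
  constructor <;> nlinarith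

lemma Elay_layer {c₀ ε a t e : ℝ} (hc₀ : 0 < c₀) (hε : 0 < ε) (ht : t ∈ Icc a (1 - a))
    (he : Real.exp (-(c₀ / ε) * a) ≤ e) : Elay (c₀ / ε) t ≤ 2 * e := by
  have hk : 0 < c₀ / ε := by positivity
  have h1 : Real.exp (-(c₀ / ε) * t) ≤ e := by
    refine le_trans (Real.exp_le_exp.mpr ?_) he
    nlinarith [ht.1]
  have h2 : Real.exp (-(c₀ / ε) * (1 - t)) ≤ e := by
    refine le_trans (Real.exp_le_exp.mpr ?_) he
    nlinarith [ht.2]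
  unfold Elay
  linarith

lemma mk_setup (hc₀ : 0 < c₀) (hK : 0 < K) (hε : 0 < ε) (hε1 : ε ≤ 1) (hm : 0 < m) :
    Setup c₀ K ε (4 * m) (Real.log ((4 * m : ℕ) : ℝ)) (8 / min c₀ 1)
      (2 * Real.exp (c₀ * (8 / min c₀ 1)))
      (alph (min c₀ 1) ε (4 * m)) (alph (min c₀ 1) ε (4 * m) / m)
      ((1 - 2 * alph (min c₀ 1) ε (4 * m)) / (2 * m)) := by
  have hmR : (1:ℝ) ≤ m := by exact_mod_cast hm
  have hm0 : (0:ℝ) < m := by linarith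
  set γ := min c₀ 1 with hγ
  have hγ0 : 0 < γ := lt_min hc₀ one_pos
  have hγc : γ ≤ c₀ := min_le_left _ _
  have hL : 1 ≤ Real.log ((4 * m : ℕ) : ℝ) := by
    rw [Real.le_log_iff_exp_le (by positivity)]
    push_cast
    linarith [Real.exp_one_lt_three]
  have hLn : Real.log ((4 * m : ℕ) : ℝ) ≤ 4 * m := by
    have := Real.log_le_self (show (0:ℝ) ≤ ((4 * m : ℕ) : ℝ) by positivity)
    push_cast at this ⊢
    exact this
  have hexp : Real.exp (Real.log ((4 * m : ℕ) : ℝ)) = 4 * m := by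
    rw [Real.exp_log (by positivity)]; push_cast; rfl
  have hαdef : alph γ ε (4 * m) = min (1/4) (2 * γ⁻¹ * ε * Real.log ((4 * m : ℕ) : ℝ)) := rfl
  set L := Real.log ((4 * m : ℕ) : ℝ) with hLd
  set α := alph γ ε (4 * m) with hα
  have hα2 : α ≤ 2 * γ⁻¹ * ε * L := by rw [hαdef]; exact min_le_right _ _
  have hα4 : α ≤ 1 / 4 := by rw [hαdef]; exact min_le_left _ _
  have hα0 : 0 < α := by rw [hαdef]; exact lt_min (by norm_num) (by positivity)
  have hfκ : α / m / ε ≤ 8 / γ * (L / (4 * m)) := by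
    rw [div_div, div_le_iff₀ (by positivity)]
    refine hα2.trans (le_of_eq ?_)
    field_simp; ring
  refine ⟨hc₀, hK, hε, hε1, by positivity, hL, by positivity, by positivity, hα0, hα4, ?_,
    by positivity, hfκ, div_le_self hα0.le hmR, ?_, ?_, ?_⟩
  · refine hα2.trans ?_
    have : 0 ≤ γ⁻¹ * ε * L := by positivity
    rw [div_eq_mul_inv]; linarith
  · rw [div_le_div_iff₀ hm0 (by positivity)]; nlinarith
  · rw [div_le_div_iff₀ (by positivity) (by positivity)]; nlinarith
  · rcases le_total (1/4) (2 * γ⁻¹ * ε * L) with h | h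
    · left
      have : α = 1 / 4 := by rw [hαdef]; exact min_eq_left h
      rw [this]; field_simp; norm_num
    · right
      have hαe : α = 2 * γ⁻¹ * ε * L := by rw [hαdef]; exact min_eq_right h
      intro t ht
      have := Elay_layer (a := α - α / m) (t := t) hc₀ hε
        (e := Real.exp (c₀ * (8 / γ)) / (4 * m) ^ 2) ⟨ht.1, by linarith [ht.2]⟩ ?_
      · refine this.trans (le_of_eq ?_)
        ring
      · have e1 : Real.exp (c₀ * (8 / γ)) / (4 * m) ^ 2
            = Real.exp (c₀ * (8 / γ) - 2 * L) := by
          rw [Real.exp_sub, ← hexp, ← Real.exp_nat_mul]; norm_num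
        rw [e1]
        apply Real.exp_le_exp.mpr
        have e2 : -(c₀ / ε) * (α - α / m) = c₀ * (α / m / ε) - 2 * (c₀ / γ * L) := by
          have : α / ε = 2 * γ⁻¹ * L := by rw [hαe]; field_simp
          have e3 : -(c₀ / ε) * (α - α / m) = c₀ * (α / m / ε) - c₀ * (α / ε) := by ring
          rw [e3, this]; ring
        rw [e2]
        have h3 : α / m / ε ≤ 8 / γ := by
          refine hfκ.trans ?_
          have : L / (4 * m) ≤ 1 := (div_le_one (by positivity)).mpr hLn
          exact mul_le_of_le_one_right (by positivity) this
        have h4 : L ≤ c₀ / γ * L := by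
          have : 1 ≤ c₀ / γ := (one_le_div hγ0).mpr hγc
          nlinarith
        have := mul_le_mul_of_nonneg_left h3 hc₀.le
        linarith

end asm2

/-- ε-uniform bound for the piecewise-linear interpolant of the
discrete solution on the Shishkin mesh with `γ₀ = min(c₀,1)`. -/
theorem stmt_16 (f : ℝ → ℝ → ℝ) (c₀ : ℝ) (hc₀ : 0 < c₀)
    (hf : SmoothF f) (hfu : LowerF f c₀) :
    ∃ C : ℝ, 0 < C ∧
      ∀ ε ∈ Ioc (0:ℝ) 1, ∀ N : ℕ, 4 ≤ N → 4 ∣ N →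
      ∀ u : ℝ → ℝ, IsSolution f ε u →
      ∀ y : ℕ → ℝ, NonlinScheme f ε (shishkinMesh (min c₀ 1) ε N) N y →
      ∀ yI : ℝ → ℝ, IsLinInterp (shishkinMesh (min c₀ 1) ε N) N y yI →
        ∀ x ∈ Icc (0:ℝ) 1,
          |yI x - u x| ≤ C * ((N:ℝ) ^ 2)⁻¹ * (Real.log N) ^ 2 := by
  obtain ⟨K, hK, hsol⟩ := solution_bounds hc₀ hf hfu
  set κ : ℝ := 8 / min c₀ 1 with hκd
  set Cp : ℝ := 2 * Real.exp (c₀ * (8 / min c₀ 1)) with hCd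
  have hκ : 0 < κ := div_pos (by norm_num) (lt_min hc₀ one_pos)
  have hCp : 0 < Cp := by positivity
  refine ⟨NdC c₀ K κ Cp + InC c₀ K κ Cp, ?_, ?_⟩
  · unfold NdC InC TrC
    positivity
  intro ε hε N hN hdvd u hu y hy yI hyI t ht
  obtain ⟨m, rfl⟩ := hdvd
  have hm : 0 < m := by omega
  have S := mk_setup hc₀ hK hε.1 hε.2 hm
  have hM := mesh_spec (γ := min c₀ 1) (ε := ε) hm S.hα
  obtain ⟨u1, p1, p2, b1, b2, b3, b4⟩ := hsol ε hε u hu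
  have hS : SolB c₀ K ε u u1 (fun x => f x (u x)) p1 p2 := ⟨b1, b2, b3, b4⟩
  have hstep := step_pos hM S.hf0 (S.hf0.trans_le S.hfc)
  obtain ⟨i, hi, hti⟩ := find_cell (x := shishkinMesh (min c₀ 1) ε (4 * m)) (N := 4 * m) (t := t) (by rw [hM.x0]; exact ht.1)
    (by rw [hM.xN]; exact ht.2) (by omega)
  have nod : ∀ j ≤ 4 * m, _ := fun j hj =>
    nodal S hS hM hm (fun x hx a b hab => f_mono hf hfu hx hab) hu.2.2.1 hu.2.2.2 hy hj
  have h1 := lin_err (hstep i hi) hti (nod i hi.le) (nod (i + 1) hi)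
  have h2 := interp_all S hS hM hi hti
  rw [hyI.2 i hi t hti]
  have h3 := (abs_sub_le _ _ _).trans (add_le_add h1 h2)
  refine h3.trans (le_of_eq ?_)
  push_cast
  ring
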